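/- Linear Stam inequality with quantum conditioning: Let X and Y be random variables with values in ℝⁿ correlated with a finite-dimensional quantum system M, with E‖X‖² and E‖Y‖² finite, with the map (x,y) ↦ ρ(x,y) (the state of M conditioned on X = x, Y = y) continuous in trace norm, with all conditional entropies involved finite, and with I(X:Y|M) = 0. Then for every 0 ≤ λ ≤ 1, J(X+Y|M) ≤ λ² J(X|M) + (1−λ)² J(Y|M), where J(·|M) is the conditional Fisher information. -/

import Mathlib

open MeasureTheory Real Filter Topology
open scoped ComplexOrder

noncomputable section

/-- `ℝⁿ`. -/
abbrev En (n : ℕ) := EuclideanSpace ℝ (Fin n)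

/-- The density of the standard Gaussian probability measure on `ℝⁿ`. -/
def gaussDensity (n : ℕ) (z : En n) : ℝ :=
  (2 * π) ^ (-(n : ℝ) / 2) * Real.exp (-‖z‖ ^ 2 / 2)

/-- A state of a finite-dimensional quantum system: a positive semidefinite matrix
with unit trace. -/
def IsState {ι : Type*} [Fintype ι] [DecidableEq ι] (ρ : Matrix ι ι ℂ) : Prop :=
  ρ.PosSemidef ∧ ρ.trace = 1

open scoped Classical in
/-- The von Neumann entropy `S(ρ) = -Σᵢ λᵢ ln λᵢ` of a (Hermitian) matrix, the sum running
over its eigenvalues (with the convention `0 ln 0 = 0`; junk value `0` on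
non-Hermitian matrices). -/
def vnEnt {ι : Type*} [Fintype ι] [DecidableEq ι] (ρ : Matrix ι ι ℂ) : ℝ :=
  if h : ρ.IsHermitian then -∑ i, h.eigenvalues i * Real.log (h.eigenvalues i) else 0

/-- The classical (differential or discrete) entropy `S = -∫ p ln p` of a density `p`. -/
def clEnt {α : Type*} [MeasureSpace α] (p : α → ℝ) : ℝ := -∫ a, p a * Real.log (p a)

/-- The average state `∫ p(a) ρ(a) da` of a classical-quantum state. -/
def avgState {α : Type*} [MeasureSpace α] {d : ℕ} (p : α → ℝ)
    (ρ : α → Matrix (Fin d) (Fin d) ℂ) : Matrix (Fin d) (Fin d) ℂ :=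
  Matrix.of fun i j => ∫ a, (p a : ℂ) * ρ a i j

/-- The conditional entropy `S(A|M) = S(M|A) + S(A) - S(M)` of the classical system `A`
of a classical-quantum state `(p, ρ)` given the quantum system `M`. -/
def condEnt {α : Type*} [MeasureSpace α] {d : ℕ} (p : α → ℝ)
    (ρ : α → Matrix (Fin d) (Fin d) ℂ) : ℝ :=
  (∫ a, p a * vnEnt (ρ a)) + clEnt p - vnEnt (avgState p ρ)

/-- The integrability conditions expressing that the conditional entropy `S(A|M)` of the
classical-quantum state `(p, ρ)` is finite. -/
def EntFinite {α : Type*} [MeasureSpace α] {d : ℕ} (p : α → ℝ)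
    (ρ : α → Matrix (Fin d) (Fin d) ℂ) : Prop :=
  Integrable (fun a => p a * Real.log (p a)) ∧ Integrable (fun a => p a * vnEnt (ρ a))

/-- The marginal density of the first variable of a joint density on `ℝⁿ × ℝⁿ`. -/
def margFst {n : ℕ} (p : En n × En n → ℝ) : En n → ℝ := fun x => ∫ y, p (x, y)

/-- The state of `M` conditioned on the first classical variable:
`ρ_X(x) = (∫ p(x,y) ρ(x,y) dy) / p_X(x)`. -/
def margFstState {n d : ℕ} (p : En n × En n → ℝ)
    (ρ : En n × En n → Matrix (Fin d) (Fin d) ℂ) : En n → Matrix (Fin d) (Fin d) ℂ :=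
  fun x => ((margFst p x : ℂ))⁻¹ • Matrix.of fun i j => ∫ y, (p (x, y) : ℂ) * ρ (x, y) i j

/-- The marginal density of the second variable of a joint density on `ℝⁿ × ℝⁿ`. -/
def margSnd {n : ℕ} (p : En n × En n → ℝ) : En n → ℝ := fun y => ∫ x, p (x, y)

/-- The state of `M` conditioned on the second classical variable. -/
def margSndState {n d : ℕ} (p : En n × En n → ℝ)
    (ρ : En n × En n → Matrix (Fin d) (Fin d) ℂ) : En n → Matrix (Fin d) (Fin d) ℂ :=
  fun y => ((margSnd p y : ℂ))⁻¹ • Matrix.of fun i j => ∫ x, (p (x, y) : ℂ) * ρ (x, y) i j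

/-- The density of the sum `X + Y`: `p_S(s) = ∫ p(x, s - x) dx`. -/
def sumDensity {n : ℕ} (p : En n × En n → ℝ) : En n → ℝ := fun s => ∫ x, p (x, s - x)

/-- The state of `M` conditioned on `X + Y = s`. -/
def sumState {n d : ℕ} (p : En n × En n → ℝ)
    (ρ : En n × En n → Matrix (Fin d) (Fin d) ℂ) : En n → Matrix (Fin d) (Fin d) ℂ :=
  fun s => ((sumDensity p s : ℂ))⁻¹ •
    Matrix.of fun i j => ∫ x, (p (x, s - x) : ℂ) * ρ (x, s - x) i j

/-- The conditional mutual information `I(X:Y|M) = S(X|M) + S(Y|M) - S(X,Y|M)` of the two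
classical variables of a joint classical-quantum state on `ℝⁿ × ℝⁿ` given `M`. -/
def condMI {n d : ℕ} (p : En n × En n → ℝ)
    (ρ : En n × En n → Matrix (Fin d) (Fin d) ℂ) : ℝ :=
  condEnt (margFst p) (margFstState p ρ) + condEnt (margSnd p) (margSndState p ρ)
    - condEnt p ρ

/-- The joint density of `(A + c Z, Z)` where `A` has density `q` and `Z` is an independent
standard Gaussian. -/
def noisyDensity {n : ℕ} (c : ℝ) (q : En n → ℝ) : En n × En n → ℝ :=
  fun wz => gaussDensity n wz.2 * q (wz.1 - c • wz.2)

/-- The state of `M` conditioned on `A + c Z = w` and `Z = z`, namely `σ(w - c z)`. -/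
def noisyState {n d : ℕ} (c : ℝ) (σ : En n → Matrix (Fin d) (Fin d) ℂ) :
    En n × En n → Matrix (Fin d) (Fin d) ℂ :=
  fun wz => σ (wz.1 - c • wz.2)

/-- The mutual information `I(A + c Z : Z | M)` for a classical-quantum state `(q, σ)`. -/
def noisyMI {n d : ℕ} (c : ℝ) (q : En n → ℝ) (σ : En n → Matrix (Fin d) (Fin d) ℂ) : ℝ :=
  condMI (noisyDensity c q) (noisyState c σ)

/-- The heat-semigroup-evolved conditional entropy `t ↦ S(A + √t Z | M)`. -/
def heatEnt {n d : ℕ} (q : En n → ℝ) (σ : En n → Matrix (Fin d) (Fin d) ℂ) (t : ℝ) : ℝ :=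
  condEnt (margFst (noisyDensity (Real.sqrt t) q))
    (margFstState (noisyDensity (Real.sqrt t) q) (noisyState (Real.sqrt t) σ))

/-- The difference quotient `I(A + √t Z : Z | M) / t` whose limit as `t → 0⁺` is the
conditional Fisher information `J(A|M)`. -/
def fisherSlope {n d : ℕ} (q : En n → ℝ) (σ : En n → Matrix (Fin d) (Fin d) ℂ) (t : ℝ) : ℝ :=
  noisyMI (Real.sqrt t) q σ / t

/-- The conditional Fisher information `J(A|M) = lim_{t→0⁺} I(A + √t Z : Z | M) / t`, as an
extended real number (the limit always exists, and is computed here as a `limsup`). -/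
def condFisher {n d : ℕ} (q : En n → ℝ) (σ : En n → Matrix (Fin d) (Fin d) ℂ) : EReal :=
  Filter.limsup (fun t : ℝ => ((fisherSlope q σ t : ℝ) : EReal)) (𝓝[>] (0 : ℝ))

/-- The basic regularity hypotheses on a classical-quantum state `(p, ρ)`:
`p` is a probability density and `ρ` is a (trace-norm continuous) family of states. -/
def IsCQState {α : Type*} [MeasureSpace α] [TopologicalSpace α] {d : ℕ} (p : α → ℝ)
    (ρ : α → Matrix (Fin d) (Fin d) ℂ) : Prop :=
  Measurable p ∧ (∀ a, 0 ≤ p a) ∧ (∫ a, p a) = 1 ∧ Continuous ρ ∧ ∀ a, IsState (ρ a)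


section MatrixPart
open Matrix

variable {d : ℕ}

/-- Function of a Hermitian matrix through its spectral decomposition. -/
def mfun (f : ℝ → ℝ) (A : Matrix (Fin d) (Fin d) ℂ) : Matrix (Fin d) (Fin d) ℂ :=
  open scoped Classical in
  if h : A.IsHermitian then
    (h.eigenvectorUnitary : Matrix (Fin d) (Fin d) ℂ) *
      Matrix.diagonal (fun i => ((f (h.eigenvalues i) : ℝ) : ℂ)) *
      (h.eigenvectorUnitary : Matrix (Fin d) (Fin d) ℂ)ᴴ
  else 0

lemma mfun_of (f : ℝ → ℝ) {A : Matrix (Fin d) (Fin d) ℂ} (h : A.IsHermitian) :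
    mfun f A = (h.eigenvectorUnitary : Matrix (Fin d) (Fin d) ℂ) *
      Matrix.diagonal (fun i => ((f (h.eigenvalues i) : ℝ) : ℂ)) *
      (h.eigenvectorUnitary : Matrix (Fin d) (Fin d) ℂ)ᴴ := by
  unfold mfun; rw [dif_pos h]

lemma eu_left {A : Matrix (Fin d) (Fin d) ℂ} (h : A.IsHermitian) :
    (h.eigenvectorUnitary : Matrix (Fin d) (Fin d) ℂ)ᴴ *
      (h.eigenvectorUnitary : Matrix (Fin d) (Fin d) ℂ) = 1 := by
  have := Unitary.coe_star_mul_self h.eigenvectorUnitary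
  simpa [Matrix.star_eq_conjTranspose] using this

lemma eu_right {A : Matrix (Fin d) (Fin d) ℂ} (h : A.IsHermitian) :
    (h.eigenvectorUnitary : Matrix (Fin d) (Fin d) ℂ) *
      (h.eigenvectorUnitary : Matrix (Fin d) (Fin d) ℂ)ᴴ = 1 := by
  have := Unitary.coe_mul_star_self h.eigenvectorUnitary
  simpa [Matrix.star_eq_conjTranspose] using this

lemma spec_eq {A : Matrix (Fin d) (Fin d) ℂ} (h : A.IsHermitian) :
    A = (h.eigenvectorUnitary : Matrix (Fin d) (Fin d) ℂ) *
      Matrix.diagonal (fun i => ((h.eigenvalues i : ℝ) : ℂ)) *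
      (h.eigenvectorUnitary : Matrix (Fin d) (Fin d) ℂ)ᴴ := by
  conv_lhs => rw [h.spectral_theorem]
  rfl

lemma mfun_id {A : Matrix (Fin d) (Fin d) ℂ} (h : A.IsHermitian) :
    mfun (fun x => x) A = A := by
  rw [mfun_of _ h]; exact (spec_eq h).symm

lemma vnEnt_of {A : Matrix (Fin d) (Fin d) ℂ} (h : A.IsHermitian) :
    vnEnt A = -∑ i, h.eigenvalues i * Real.log (h.eigenvalues i) := by
  unfold vnEnt; rw [dif_pos h]

lemma eig_sum_of_diag (f : ℝ → ℝ) {A U : Matrix (Fin d) (Fin d) ℂ} (h : A.IsHermitian)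
    (hU : Uᴴ * U = 1) (y : Fin d → ℝ)
    (hA : A = U * Matrix.diagonal (fun i => ((y i : ℝ) : ℂ)) * Uᴴ) :
    ∑ i, f (h.eigenvalues i) = ∑ i, f (y i) := by
  have h1 := h.roots_charpoly_eq_eigenvalues
  have h2 : A.charpoly = ∏ i, (Polynomial.X - Polynomial.C ((y i : ℝ) : ℂ)) := by
    rw [hA, charpoly_mul_comm, ← mul_assoc, hU, one_mul, charpoly_diagonal]
  rw [h2, Polynomial.roots_prod _ _ (Finset.prod_ne_zero_iff.2 fun i _ => Polynomial.X_sub_C_ne_zero _)] at h1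
  simp only [Polynomial.roots_X_sub_C, Multiset.bind_singleton] at h1
  have h3 := congrArg (fun m => (m.map (fun c : ℂ => f c.re)).sum) h1
  simp only [Multiset.map_map, Function.comp_def, Complex.ofReal_re] at h3
  exact h3.symm

lemma eig_trace {A : Matrix (Fin d) (Fin d) ℂ} (h : A.IsHermitian) :
    A.trace.re = ∑ i, h.eigenvalues i := by
  rw [h.trace_eq_sum_eigenvalues]; simp

/-- Frobenius-type expansions in two orthonormal bases. -/
lemma tr_left (B C : Matrix (Fin d) (Fin d) ℂ) (x : Fin d → ℝ) :
    (Bᴴ * Matrix.diagonal (fun i => ((x i : ℝ) : ℂ)) * C).trace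
      = ∑ i, ∑ j, (x i : ℂ) * (star (B i j) * C i j) := by
  rw [Finset.sum_comm]
  simp only [Matrix.trace, Matrix.diag]
  simp_rw [Matrix.mul_apply (M := Bᴴ * _), Matrix.mul_diagonal, conjTranspose_apply]
  exact Finset.sum_congr rfl fun j _ => Finset.sum_congr rfl fun i _ => by ring

lemma tr_right (B C : Matrix (Fin d) (Fin d) ℂ) (y : Fin d → ℝ) :
    (Bᴴ * C * Matrix.diagonal (fun i => ((y i : ℝ) : ℂ))).trace
      = ∑ i, ∑ j, (y j : ℂ) * (star (B i j) * C i j) := by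
  rw [Finset.sum_comm]
  simp only [Matrix.trace, Matrix.diag]
  simp_rw [Matrix.mul_diagonal, Matrix.mul_apply, conjTranspose_apply, Finset.sum_mul]
  exact Finset.sum_congr rfl fun j _ => Finset.sum_congr rfl fun i _ => by ring

lemma tr_two (U V : Matrix (Fin d) (Fin d) ℂ) (x y : Fin d → ℝ) :
    ((U * Matrix.diagonal (fun i => ((x i : ℝ) : ℂ)) * Uᴴ) *
      (V * Matrix.diagonal (fun i => ((y i : ℝ) : ℂ)) * Vᴴ)).trace.re
      = ∑ i, ∑ j, Complex.normSq ((Uᴴ * V) i j) * (x i * y j) := by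
  have h : ((U * Matrix.diagonal (fun i => ((x i : ℝ) : ℂ)) * Uᴴ) *
      (V * Matrix.diagonal (fun i => ((y i : ℝ) : ℂ)) * Vᴴ)).trace
      = ((Uᴴ * V)ᴴ * Matrix.diagonal (fun i => ((x i : ℝ) : ℂ)) * ((Uᴴ * V) *
        Matrix.diagonal (fun i => ((y i : ℝ) : ℂ)))).trace := by
    rw [conjTranspose_mul, conjTranspose_conjTranspose,
      show (U * Matrix.diagonal (fun i => ((x i : ℝ) : ℂ)) * Uᴴ) *
      (V * Matrix.diagonal (fun i => ((y i : ℝ) : ℂ)) * Vᴴ)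
      = (U * Matrix.diagonal (fun i => ((x i : ℝ) : ℂ)) * Uᴴ *
      V * Matrix.diagonal (fun i => ((y i : ℝ) : ℂ))) * Vᴴ by simp only [mul_assoc],
      Matrix.trace_mul_comm]
    simp only [mul_assoc]
  rw [h, tr_left]
  simp only [Complex.re_sum, Matrix.mul_diagonal]
  refine Finset.sum_congr rfl fun i _ => Finset.sum_congr rfl fun j _ => ?_
  have : (x i : ℂ) * (star ((Uᴴ * V) i j) * ((Uᴴ * V) i j * (y j : ℂ)))
     = ((Complex.normSq ((Uᴴ * V) i j) * (x i * y j) : ℝ) : ℂ) := by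
    push_cast
    rw [Complex.normSq_eq_conj_mul_self]
    simp only [Complex.star_def]; ring
  rw [this, Complex.ofReal_re]

lemma unit_row {M : Matrix (Fin d) (Fin d) ℂ} (hM : M * Mᴴ = 1) (i : Fin d) :
    ∑ j, Complex.normSq (M i j) = 1 := by
  have := congrFun (congrFun hM i) i
  simp only [mul_apply, conjTranspose_apply, one_apply_eq] at this
  have h2 := congrArg Complex.re this
  simpa [Complex.mul_conj, Complex.star_def] using h2

lemma unit_col {M : Matrix (Fin d) (Fin d) ℂ} (hM : Mᴴ * M = 1) (j : Fin d) :
    ∑ i, Complex.normSq (M i j) = 1 := by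
  have := congrFun (congrFun hM j) j
  simp only [mul_apply, conjTranspose_apply, one_apply_eq] at this
  have h2 := congrArg Complex.re this
  simpa only [Complex.star_def, ← Complex.normSq_eq_conj_mul_self, Complex.re_sum,
    Complex.ofReal_re, Complex.one_re] using h2

/-- overlap matrix of two eigenbases -/
def ovl {A B : Matrix (Fin d) (Fin d) ℂ} (hA : A.IsHermitian) (hB : B.IsHermitian) :
    Matrix (Fin d) (Fin d) ℂ :=
  (hA.eigenvectorUnitary : Matrix (Fin d) (Fin d) ℂ)ᴴ *
    (hB.eigenvectorUnitary : Matrix (Fin d) (Fin d) ℂ)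

lemma ovl_row {A B : Matrix (Fin d) (Fin d) ℂ} (hA : A.IsHermitian) (hB : B.IsHermitian)
    (i : Fin d) : ∑ j, Complex.normSq (ovl hA hB i j) = 1 := by
  apply unit_row
  unfold ovl
  rw [conjTranspose_mul, conjTranspose_conjTranspose, mul_assoc, ← mul_assoc _ _
    (hA.eigenvectorUnitary : Matrix (Fin d) (Fin d) ℂ), eu_right, one_mul, eu_left]

lemma ovl_col {A B : Matrix (Fin d) (Fin d) ℂ} (hA : A.IsHermitian) (hB : B.IsHermitian)
    (j : Fin d) : ∑ i, Complex.normSq (ovl hA hB i j) = 1 := by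
  apply unit_col
  unfold ovl
  rw [conjTranspose_mul, conjTranspose_conjTranspose, mul_assoc, ← mul_assoc _ _
    (hB.eigenvectorUnitary : Matrix (Fin d) (Fin d) ℂ), eu_right, one_mul, eu_left]

/-- `Re Tr (A f(B))`. -/
lemma tr_mfun (f : ℝ → ℝ) {A B : Matrix (Fin d) (Fin d) ℂ} (hA : A.IsHermitian)
    (hB : B.IsHermitian) : (A * mfun f B).trace.re
      = ∑ i, ∑ j, Complex.normSq (ovl hA hB i j) * (hA.eigenvalues i * f (hB.eigenvalues j)) := by
  rw [mfun_of f hB]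
  conv_lhs => rw [spec_eq hA]
  rw [tr_two]; rfl

lemma vnEnt_eq_tr {A : Matrix (Fin d) (Fin d) ℂ} (h : A.IsHermitian) :
    vnEnt A = -(A * mfun Real.log A).trace.re := by
  have hs : (A * mfun Real.log A).trace.re = (((h.eigenvectorUnitary : Matrix (Fin d) (Fin d) ℂ) *
      Matrix.diagonal (fun i => ((h.eigenvalues i : ℝ) : ℂ)) *
      (h.eigenvectorUnitary : Matrix (Fin d) (Fin d) ℂ)ᴴ) * mfun Real.log A).trace.re := by
    rw [← spec_eq h]
  rw [vnEnt_of h, hs, mfun_of _ h, tr_two, eu_left]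
  congr 1
  refine Finset.sum_congr rfl fun i _ => ?_
  rw [Finset.sum_eq_single i]
  · simp
  · intro j _ hj; simp [Matrix.one_apply_ne (Ne.symm hj)]
  · simp

lemma vnEnt_zero : vnEnt (0 : Matrix (Fin d) (Fin d) ℂ) = 0 := by
  rw [vnEnt_eq_tr Matrix.isHermitian_zero]; simp

end MatrixPart

section TangentPart
open Matrix

variable {d : ℕ}

lemma seg_pos {x y u : ℝ} (hx : 0 < x) (hy : 0 < y) (hu : u ∈ Set.Icc (0:ℝ) 1) :
    0 < y + u * (x - y) := by
  obtain ⟨h0, h1⟩ := hu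
  have : y + u * (x - y) = (1 - u) * y + u * x := by ring
  rw [this]
  rcases eq_or_lt_of_le h0 with h | h
  · rw [← h]; simpa using hy
  · have : 0 ≤ (1 - u) * y := mul_nonneg (by linarith) hy.le
    have := mul_pos h hx
    linarith

lemma scal_cont {x y : ℝ} (hx : 0 < x) (hy : 0 < y) :
    ContinuousOn (fun u : ℝ => (1 - u) * ((x - y) ^ 2 / (y + u * (x - y)))) (Set.uIcc 0 1) := by
  rw [Set.uIcc_of_le zero_le_one]
  refine ContinuousOn.mul (by fun_prop) (ContinuousOn.div (by fun_prop) (by fun_prop) ?_)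
  intro u hu; exact (seg_pos hx hy hu).ne'

lemma scal_eq {x y : ℝ} (hx : 0 < x) (hy : 0 < y) :
    ∫ u in (0:ℝ)..1, (1 - u) * ((x - y) ^ 2 / (y + u * (x - y)))
      = x * Real.log x - x * Real.log y - (x - y) := by
  have key : ∀ u ∈ Set.uIcc (0:ℝ) 1, HasDerivAt
      (fun u : ℝ => (1 - u) * ((x - y) * (Real.log (y + u * (x - y)) + 1))
        + (y + u * (x - y)) * Real.log (y + u * (x - y)))
      ((1 - u) * ((x - y) ^ 2 / (y + u * (x - y)))) u := by
    intro u hu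
    rw [Set.uIcc_of_le zero_le_one] at hu
    have hp := seg_pos hx hy hu
    have hm : HasDerivAt (fun u : ℝ => y + u * (x - y)) (x - y) u := by
      simpa using ((hasDerivAt_id u).mul_const (x - y)).const_add y
    have hl := hm.log hp.ne'
    have h1 : HasDerivAt (fun u : ℝ => 1 - u) (-1) u := by
      simpa using (hasDerivAt_id u).const_sub 1
    have := (h1.mul ((hl.add_const 1).const_mul (x - y))).add (hm.mul hl)
    have hne := hp.ne'
    refine this.congr_deriv ?_
    rw [mul_div_cancel₀ _ hne]
    ring
  rw [intervalIntegral.integral_eq_sub_of_hasDerivAt key (scal_cont hx hy).intervalIntegrable]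
  simp
  ring

lemma quad_le (w M : ℂ) (t : ℝ) {m : ℝ} (hm : 0 < m) :
    2 * (star w * M).re * t - Complex.normSq w * m ≤ Complex.normSq M * (t ^ 2 / m) := by
  have h : 0 ≤ Complex.normSq (m * w - t * M) := Complex.normSq_nonneg _
  have h2 : Complex.normSq (m * w - t * M) =
     m ^ 2 * Complex.normSq w + t ^ 2 * Complex.normSq M - 2 * m * t * (star w * M).re := by
    simp [Complex.normSq_apply]; ring
  rw [← mul_div_assoc, le_div_iff₀ hm]
  nlinarith

lemma scal_le {x y : ℝ} (hx : 0 ≤ x) (hy : 0 < y) (M : ℂ) {w : ℝ → ℂ}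
    (hw : ContinuousOn w (Set.uIcc 0 1)) :
    ∫ u in (0:ℝ)..1, (1 - u) * (2 * (star (w u) * M).re * (x - y)
        - Complex.normSq (w u) * (y + u * (x - y)))
      ≤ Complex.normSq M * (x * Real.log x - x * Real.log y - (x - y)) := by
  have hns : ContinuousOn (fun u => Complex.normSq (w u)) (Set.uIcc 0 1) :=
    Complex.continuous_normSq.comp_continuousOn hw
  have hre : ContinuousOn (fun u => (star (w u) * M).re) (Set.uIcc 0 1) := by
    refine Complex.continuous_re.comp_continuousOn ?_
    exact (continuous_star.comp_continuousOn hw).mul continuousOn_const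
  have hc : ContinuousOn (fun u : ℝ => (1 - u) * (2 * (star (w u) * M).re * (x - y)
        - Complex.normSq (w u) * (y + u * (x - y)))) (Set.uIcc 0 1) := by
    fun_prop
  rcases eq_or_lt_of_le hx with h | h
  · subst h
    have : Complex.normSq M * (0 * Real.log 0 - 0 * Real.log y - (0 - y))
      = ∫ u in (0:ℝ)..1, Complex.normSq M * y := by simp
    rw [this]
    refine intervalIntegral.integral_mono_on zero_le_one hc.intervalIntegrable
      (by simp) ?_
    intro u hu
    have h0 : 0 ≤ Complex.normSq ((1 - u : ℝ) * w u + M) := Complex.normSq_nonneg _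
    have h2 : Complex.normSq ((1 - u : ℝ) * w u + M) =
       (1 - u) ^ 2 * Complex.normSq (w u) + Complex.normSq M
        + 2 * (1 - u) * (star (w u) * M).re := by
      simp [Complex.normSq_apply]; ring
    nlinarith
  · rw [← scal_eq h hy, ← intervalIntegral.integral_const_mul]
    refine intervalIntegral.integral_mono_on zero_le_one hc.intervalIntegrable
      ((scal_cont h hy).intervalIntegrable.const_mul _) ?_
    intro u hu
    have := quad_le (w u) M (x - y) (seg_pos h hy hu)
    have h1 : 0 ≤ 1 - u := by linarith [hu.2]
    calc _ ≤ (1 - u) * (Complex.normSq M * ((x - y) ^ 2 / (y + u * (x - y)))) :=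
          mul_le_mul_of_nonneg_left this h1
      _ = _ := by ring

/-- Quantum relative entropy `Tr A log A - Tr A log B`. -/
def relEnt (A B : Matrix (Fin d) (Fin d) ℂ) : ℝ :=
  -vnEnt A - (A * mfun Real.log B).trace.re

lemma relEnt_eq {A B : Matrix (Fin d) (Fin d) ℂ} (hA : A.IsHermitian) (hB : B.IsHermitian) :
    relEnt A B = A.trace.re - B.trace.re + ∑ i, ∑ j, Complex.normSq (ovl hA hB i j) *
      (hA.eigenvalues i * Real.log (hA.eigenvalues i)
        - hA.eigenvalues i * Real.log (hB.eigenvalues j)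
        - (hA.eigenvalues i - hB.eigenvalues j)) := by
  have h1 : vnEnt A = -∑ i, ∑ j, Complex.normSq (ovl hA hB i j) *
      (hA.eigenvalues i * Real.log (hA.eigenvalues i)) := by
    rw [vnEnt_of hA]
    simp_rw [← Finset.sum_mul, ovl_row, one_mul]
  have h2 : A.trace.re = ∑ i, ∑ j, Complex.normSq (ovl hA hB i j) * hA.eigenvalues i := by
    rw [eig_trace hA]
    simp_rw [← Finset.sum_mul, ovl_row, one_mul]
  have h3 : B.trace.re = ∑ i, ∑ j, Complex.normSq (ovl hA hB i j) * hB.eigenvalues j := by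
    rw [eig_trace hB, Finset.sum_comm]
    simp_rw [← Finset.sum_mul, ovl_col, one_mul]
  rw [relEnt, h1, h2, h3, tr_mfun _ hA hB, neg_neg]
  simp only [← Finset.sum_sub_distrib, ← Finset.sum_add_distrib]
  exact Finset.sum_congr rfl fun i _ => Finset.sum_congr rfl fun j _ => by ring

/-- the integrand functional -/
def Tu (u : ℝ) (W A B : Matrix (Fin d) (Fin d) ℂ) : ℝ :=
  2 * (Wᴴ * A).trace.re - 2 * (Wᴴ * B).trace.re - u * (Wᴴ * A * W).trace.re
    - (1 - u) * (W * B * Wᴴ).trace.re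

lemma Tu_eq (u : ℝ) (W : Matrix (Fin d) (Fin d) ℂ) {A B : Matrix (Fin d) (Fin d) ℂ}
    (hA : A.IsHermitian) (hB : B.IsHermitian) (W' : Matrix (Fin d) (Fin d) ℂ)
    (hW' : W' = (hA.eigenvectorUnitary : Matrix (Fin d) (Fin d) ℂ)ᴴ * W *
      (hB.eigenvectorUnitary : Matrix (Fin d) (Fin d) ℂ)) :
    Tu u W A B = ∑ i, ∑ j, (2 * (star (W' i j) * ovl hA hB i j).re *
        (hA.eigenvalues i - hB.eigenvalues j)
        - Complex.normSq (W' i j) * (hB.eigenvalues j + u * (hA.eigenvalues i - hB.eigenvalues j)))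
    := by
  have hsA := spec_eq hA
  have hsB := spec_eq hB
  have hUr := eu_right hA
  have hVr := eu_right hB
  have hov : ovl hA hB = (hA.eigenvectorUnitary : Matrix (Fin d) (Fin d) ℂ)ᴴ *
    (hB.eigenvectorUnitary : Matrix (Fin d) (Fin d) ℂ) := rfl
  set M := ovl hA hB
  set x := hA.eigenvalues
  set y := hB.eigenvalues
  set U := (hA.eigenvectorUnitary : Matrix (Fin d) (Fin d) ℂ)
  set V := (hB.eigenvectorUnitary : Matrix (Fin d) (Fin d) ℂ)
  set X := Matrix.diagonal (fun i => ((x i : ℝ) : ℂ))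
  set Y := Matrix.diagonal (fun i => ((y i : ℝ) : ℂ))
  have hUr' : ∀ Z : Matrix (Fin d) (Fin d) ℂ, U * (Uᴴ * Z) = Z := fun Z => by
    rw [← mul_assoc, hUr, one_mul]
  have hVr' : ∀ Z : Matrix (Fin d) (Fin d) ℂ, V * (Vᴴ * Z) = Z := fun Z => by
    rw [← mul_assoc, hVr, one_mul]
  have hW'c : W'ᴴ = Vᴴ * Wᴴ * U := by
    rw [hW', conjTranspose_mul, conjTranspose_mul, conjTranspose_conjTranspose, mul_assoc]
  have e1 : (Wᴴ * A).trace = (W'ᴴ * X * M).trace := by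
    have : W'ᴴ * X * M = Vᴴ * (Wᴴ * A * V) := by
      rw [hW'c, hsA, hov]; simp only [mul_assoc]
    rw [this, trace_mul_comm Vᴴ]; simp only [mul_assoc, hVr, mul_one]
  have e2 : (Wᴴ * B).trace = (W'ᴴ * M * Y).trace := by
    have : W'ᴴ * M * Y = Vᴴ * (Wᴴ * (V * Y)) := by
      rw [hW'c, hov]; simp only [mul_assoc, hUr']
    rw [this, trace_mul_comm Vᴴ, hsB]; simp only [mul_assoc]
  have e3 : (Wᴴ * A * W).trace = (W'ᴴ * X * W').trace := by
    have : W'ᴴ * X * W' = Vᴴ * (Wᴴ * A * W * V) := by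
      rw [hW'c, hsA, hW']; simp only [mul_assoc]
    rw [this, trace_mul_comm Vᴴ]; simp only [mul_assoc, hVr, mul_one]
  have e4 : (W * B * Wᴴ).trace = (W'ᴴ * W' * Y).trace := by
    have : W'ᴴ * W' * Y = Vᴴ * (Wᴴ * (W * (V * Y))) := by
      rw [hW'c, hW']; simp only [mul_assoc, hUr']
    rw [this, trace_mul_comm Vᴴ, hsB]; simp only [mul_assoc]
    rw [trace_mul_comm Wᴴ]; simp only [mul_assoc]
  rw [Tu, e1, e2, e3, e4, tr_left, tr_right, tr_left, tr_right]
  simp only [Complex.re_sum, Complex.re_ofReal_mul, Finset.mul_sum, ← Finset.sum_sub_distrib]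
  refine Finset.sum_congr rfl fun i _ => Finset.sum_congr rfl fun j _ => ?_
  have : (star (W' i j) * W' i j).re = Complex.normSq (W' i j) := by
    rw [Complex.star_def, ← Complex.normSq_eq_conj_mul_self, Complex.ofReal_re]
  rw [this]; ring

lemma trace_mul_integral (A : Matrix (Fin d) (Fin d) ℂ) (F : ℝ → Matrix (Fin d) (Fin d) ℂ)
    (hF : ∀ i j, ContinuousOn (fun u => F u i j) (Set.uIcc 0 1)) :
    (A * Matrix.of fun i j => ∫ u in (0:ℝ)..1, F u i j).trace.re
      = ∫ u in (0:ℝ)..1, (A * F u).trace.re := by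
  have hI : ∀ i j, IntervalIntegrable (fun u => A i j * F u j i) volume 0 1 := fun i j =>
    ((hF j i).intervalIntegrable).const_mul _
  have h1 : (A * Matrix.of fun i j => ∫ u in (0:ℝ)..1, F u i j).trace
      = ∫ u in (0:ℝ)..1, (A * F u).trace := by
    simp only [Matrix.trace, Matrix.diag, Matrix.mul_apply, Matrix.of_apply]
    rw [intervalIntegral.integral_finsetSum]
    · refine Finset.sum_congr rfl fun i _ => ?_
      rw [intervalIntegral.integral_finsetSum]
      · refine Finset.sum_congr rfl fun j _ => ?_
        rw [intervalIntegral.integral_const_mul]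
      · exact fun j _ => hI i j
    · intro i _
      have := IntervalIntegrable.sum Finset.univ fun j _ => hI i j
      simpa [Finset.sum_fn] using this
  rw [h1]
  have hc : ContinuousOn (fun u => (A * F u).trace) (Set.uIcc 0 1) := by
    simp only [Matrix.trace, Matrix.diag, Matrix.mul_apply]
    exact continuousOn_finsetSum _ fun i _ => continuousOn_finsetSum _ fun j _ =>
      continuousOn_const.mul (hF j i)
  have := Complex.reCLM.intervalIntegral_comp_comm (a := 0) (b := 1) (μ := volume)
    (f := fun u => (A * F u).trace) hc.intervalIntegrable
  simpa using this.symm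

lemma contOn_mul {F G : ℝ → Matrix (Fin d) (Fin d) ℂ} {s : Set ℝ}
    (hF : ∀ i j, ContinuousOn (fun u => F u i j) s)
    (hG : ∀ i j, ContinuousOn (fun u => G u i j) s) :
    ∀ i j, ContinuousOn (fun u => (F u * G u) i j) s := by
  intro i j
  simp only [Matrix.mul_apply]
  exact continuousOn_finsetSum _ fun k _ => (hF i k).mul (hG k j)

/-- Supporting hyperplanes of the quantum relative entropy (joint convexity). -/
theorem relEnt_tangent {A₀ B₀ : Matrix (Fin d) (Fin d) ℂ} (hA₀ : A₀.IsHermitian)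
    (hB₀ : B₀.IsHermitian) (hA₀p : ∀ i, 0 < hA₀.eigenvalues i)
    (hB₀p : ∀ i, 0 < hB₀.eigenvalues i) :
    ∃ K L : Matrix (Fin d) (Fin d) ℂ,
      (∀ (A B : Matrix (Fin d) (Fin d) ℂ) (hA : A.IsHermitian) (hB : B.IsHermitian),
        (∀ i, 0 ≤ hA.eigenvalues i) → (∀ i, 0 < hB.eigenvalues i) →
        (A * K).trace.re + (B * L).trace.re ≤ relEnt A B) ∧
      (A₀ * K).trace.re + (B₀ * L).trace.re = relEnt A₀ B₀ := by
  set x := hA₀.eigenvalues with hx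
  set y := hB₀.eigenvalues with hy
  set U := (hA₀.eigenvectorUnitary : Matrix (Fin d) (Fin d) ℂ) with hU
  set V := (hB₀.eigenvectorUnitary : Matrix (Fin d) (Fin d) ℂ) with hV
  set W' : ℝ → Matrix (Fin d) (Fin d) ℂ := fun u => Matrix.of fun i j =>
    ovl hA₀ hB₀ i j * (((x i - y j) / (y j + u * (x i - y j)) : ℝ) : ℂ) with hW'
  set W : ℝ → Matrix (Fin d) (Fin d) ℂ := fun u => U * W' u * Vᴴ with hW
  have hW'c : ∀ i j, ContinuousOn (fun u => W' u i j) (Set.uIcc 0 1) := by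
    intro i j
    simp only [hW', Matrix.of_apply]
    refine continuousOn_const.mul (Complex.continuous_ofReal.comp_continuousOn ?_)
    refine ContinuousOn.div (by fun_prop) (by fun_prop) ?_
    intro u hu
    rw [Set.uIcc_of_le zero_le_one] at hu
    exact (seg_pos (hA₀p i) (hB₀p j) hu).ne'
  have hcc : ∀ (Z : Matrix (Fin d) (Fin d) ℂ) i j,
      ContinuousOn (fun _ : ℝ => Z i j) (Set.uIcc 0 1) := fun _ _ _ => continuousOn_const
  have hWc : ∀ i j, ContinuousOn (fun u => W u i j) (Set.uIcc 0 1) :=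
    contOn_mul (F := fun u => U * W' u) (G := fun _ => Vᴴ)
      (contOn_mul (F := fun _ => U) (G := W') (hcc U) hW'c) (hcc _)
  have hWHc : ∀ i j, ContinuousOn (fun u => (W u)ᴴ i j) (Set.uIcc 0 1) := by
    intro i j
    exact continuous_star.comp_continuousOn (hWc j i)
  have hWW := contOn_mul hWc hWHc
  have hWW' := contOn_mul hWHc hWc
  set KF : ℝ → Matrix (Fin d) (Fin d) ℂ := fun u =>
    ((1 - u : ℝ) : ℂ) • ((2 : ℂ) • (W u)ᴴ - ((u : ℝ) : ℂ) • (W u * (W u)ᴴ)) with hKF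
  set LF : ℝ → Matrix (Fin d) (Fin d) ℂ := fun u =>
    ((1 - u : ℝ) : ℂ) • (-(2 : ℂ) • (W u)ᴴ - ((1 - u : ℝ) : ℂ) • ((W u)ᴴ * W u)) with hLF
  have hco : Continuous fun u : ℝ => ((u : ℝ) : ℂ) := Complex.continuous_ofReal
  have hco1 : Continuous fun u : ℝ => ((1 - u : ℝ) : ℂ) :=
    Complex.continuous_ofReal.comp (by fun_prop)
  have hKc : ∀ i j, ContinuousOn (fun u => KF u i j) (Set.uIcc 0 1) := by
    intro i j
    simp only [hKF, Matrix.smul_apply, Matrix.sub_apply, smul_eq_mul]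
    exact hco1.continuousOn.mul ((continuousOn_const.mul (hWHc i j)).sub
      (hco.continuousOn.mul (hWW i j)))
  have hLc : ∀ i j, ContinuousOn (fun u => LF u i j) (Set.uIcc 0 1) := by
    intro i j
    simp only [hLF, Matrix.smul_apply, Matrix.sub_apply, smul_eq_mul]
    exact hco1.continuousOn.mul ((continuousOn_const.mul (hWHc i j)).sub
      (hco1.continuousOn.mul (hWW' i j)))
  have hTu : ∀ u A B, (A * KF u).trace.re + (B * LF u).trace.re = (1 - u) * Tu u (W u) A B := by
    intro u A B
    simp only [hKF, hLF, Tu, Matrix.mul_smul, Matrix.mul_sub, trace_smul, trace_sub, smul_eq_mul,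
      Complex.re_ofReal_mul, Complex.sub_re]
    rw [trace_mul_comm A, trace_mul_comm B]
    rw [show ((W u)ᴴ * A * W u).trace = (A * (W u * (W u)ᴴ)).trace by
      rw [mul_assoc, trace_mul_comm, mul_assoc]]
    rw [show (W u * B * (W u)ᴴ).trace = (B * ((W u)ᴴ * W u)).trace by
      rw [mul_assoc, trace_mul_comm, mul_assoc]]
    simp
    ring
  have hcontT : ∀ A B : Matrix (Fin d) (Fin d) ℂ, ∀ F : ℝ → Matrix (Fin d) (Fin d) ℂ,
      (∀ i j, ContinuousOn (fun u => F u i j) (Set.uIcc 0 1)) →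
      IntervalIntegrable (fun u => (A * F u).trace.re) volume 0 1 := by
    intro A B F hF
    apply ContinuousOn.intervalIntegrable
    apply Complex.continuous_re.comp_continuousOn
    simp only [Matrix.trace, Matrix.diag, Matrix.mul_apply]
    exact continuousOn_finsetSum _ fun i _ => continuousOn_finsetSum _ fun j _ =>
      continuousOn_const.mul (hF j i)
  have hval : ∀ A B : Matrix (Fin d) (Fin d) ℂ,
      (A * (1 + Matrix.of fun i j => ∫ u in (0:ℝ)..1, KF u i j)).trace.re
      + (B * (-1 + Matrix.of fun i j => ∫ u in (0:ℝ)..1, LF u i j)).trace.re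
      = A.trace.re - B.trace.re + ∫ u in (0:ℝ)..1, (1 - u) * Tu u (W u) A B := by
    intro A B
    rw [mul_add, mul_add, trace_add, trace_add, Complex.add_re, Complex.add_re,
      trace_mul_integral _ _ hKc, trace_mul_integral _ _ hLc]
    simp_rw [← hTu]
    rw [intervalIntegral.integral_add (hcontT A B _ hKc) (hcontT B A _ hLc)]
    simp
    ring
  have hexp : ∀ (A B : Matrix (Fin d) (Fin d) ℂ) (hA : A.IsHermitian) (hB : B.IsHermitian)
      (Z : ℝ → Matrix (Fin d) (Fin d) ℂ)
      (hZ : ∀ u, Z u = (hA.eigenvectorUnitary : Matrix (Fin d) (Fin d) ℂ)ᴴ * W u *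
        (hB.eigenvectorUnitary : Matrix (Fin d) (Fin d) ℂ))
      (hZc : ∀ i j, ContinuousOn (fun u => Z u i j) (Set.uIcc 0 1)),
      ∫ u in (0:ℝ)..1, (1 - u) * Tu u (W u) A B = ∑ i, ∑ j, ∫ u in (0:ℝ)..1, (1 - u) *
        (2 * (star (Z u i j) * ovl hA hB i j).re * (hA.eigenvalues i - hB.eigenvalues j)
        - Complex.normSq (Z u i j) * (hB.eigenvalues j + u *
          (hA.eigenvalues i - hB.eigenvalues j))) := by
    intro A B hA hB Z hZ hZc
    have hI : ∀ i j, IntervalIntegrable (fun u => (1 - u) *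
        (2 * (star (Z u i j) * ovl hA hB i j).re * (hA.eigenvalues i - hB.eigenvalues j)
        - Complex.normSq (Z u i j) * (hB.eigenvalues j + u *
          (hA.eigenvalues i - hB.eigenvalues j)))) volume 0 1 := by
      intro i j
      have hns : ContinuousOn (fun u => Complex.normSq (Z u i j)) (Set.uIcc 0 1) :=
        Complex.continuous_normSq.comp_continuousOn (hZc i j)
      have hre : ContinuousOn (fun u => (star (Z u i j) * ovl hA hB i j).re) (Set.uIcc 0 1) := by
        refine Complex.continuous_re.comp_continuousOn ?_
        exact (continuous_star.comp_continuousOn (hZc i j)).mul continuousOn_const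
      apply ContinuousOn.intervalIntegrable
      fun_prop
    simp_rw [fun u => Tu_eq u (W u) hA hB (Z u) (hZ u), Finset.mul_sum]
    rw [intervalIntegral.integral_finsetSum]
    · refine Finset.sum_congr rfl fun i _ => ?_
      rw [intervalIntegral.integral_finsetSum]
      exact fun j _ => hI i j
    · intro i _
      have := IntervalIntegrable.sum Finset.univ fun j _ => hI i j
      simpa [Finset.sum_fn] using this
  refine ⟨1 + Matrix.of fun i j => ∫ u in (0:ℝ)..1, KF u i j,
    -1 + Matrix.of fun i j => ∫ u in (0:ℝ)..1, LF u i j, ?_, ?_⟩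
  · intro A B hA hB hAp hBp
    have hZc := contOn_mul (F := fun u => (hA.eigenvectorUnitary : Matrix (Fin d) (Fin d) ℂ)ᴴ * W u)
      (G := fun _ => (hB.eigenvectorUnitary : Matrix (Fin d) (Fin d) ℂ))
      (contOn_mul (F := fun _ => (hA.eigenvectorUnitary : Matrix (Fin d) (Fin d) ℂ)ᴴ) (G := W)
        (hcc _) hWc) (hcc _)
    rw [hval, relEnt_eq hA hB, hexp A B hA hB _ (fun u => rfl) hZc]
    gcongr with i _ j _
    exact scal_le (hAp i) (hBp j) _ (hZc i j)
  · have hZ : ∀ u, W' u = Uᴴ * W u * V := by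
      intro u
      have h1 : Uᴴ * U = 1 := eu_left hA₀
      have h2 : Vᴴ * V = 1 := eu_left hB₀
      simp only [hW]
      calc W' u = 1 * W' u * 1 := by simp
        _ = (Uᴴ * U) * W' u * (Vᴴ * V) := by rw [h1, h2]
        _ = _ := by simp only [mul_assoc]
    rw [hval, relEnt_eq hA₀ hB₀, hexp A₀ B₀ hA₀ hB₀ W' hZ hW'c]
    congr 1
    refine Finset.sum_congr rfl fun i _ => Finset.sum_congr rfl fun j _ => ?_
    rw [← scal_eq (hA₀p i) (hB₀p j), ← intervalIntegral.integral_const_mul]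
    apply intervalIntegral.integral_congr
    intro u hu
    rw [Set.uIcc_of_le zero_le_one] at hu
    have hpos := seg_pos (hA₀p i) (hB₀p j) hu
    simp only [hW', Matrix.of_apply]
    rw [← hx, ← hy] at *
    set m := y j + u * (x i - y j) with hm
    have e1 : (star (ovl hA₀ hB₀ i j * (((x i - y j) / m : ℝ) : ℂ)) * ovl hA₀ hB₀ i j).re
        = Complex.normSq (ovl hA₀ hB₀ i j) * ((x i - y j) / m) := by
      have : star (ovl hA₀ hB₀ i j * (((x i - y j) / m : ℝ) : ℂ)) * ovl hA₀ hB₀ i j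
        = ((Complex.normSq (ovl hA₀ hB₀ i j) * ((x i - y j) / m) : ℝ) : ℂ) := by
        rw [Complex.ofReal_mul, Complex.normSq_eq_conj_mul_self, star_mul', Complex.star_def,
          Complex.conj_ofReal]
        ring
      rw [this, Complex.ofReal_re]
    rw [e1, Complex.normSq_mul, Complex.normSq_ofReal]
    field_simp
    ring

end TangentPart

section MeasMatrix
open Matrix

variable {d : ℕ} {α : Type*} [MeasurableSpace α]

/-- Entrywise integral of a matrix-valued function. -/
def mint (μ : Measure α) (R : α → Matrix (Fin d) (Fin d) ℂ) : Matrix (Fin d) (Fin d) ℂ :=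
  Matrix.of fun i j => ∫ a, R a i j ∂μ

lemma mint_apply (μ : Measure α) (R : α → Matrix (Fin d) (Fin d) ℂ) (i j : Fin d) :
    mint μ R i j = ∫ a, R a i j ∂μ := rfl

lemma mint_herm {μ : Measure α} {R : α → Matrix (Fin d) (Fin d) ℂ}
    (h : ∀ a, (R a).IsHermitian) : (mint μ R).IsHermitian := by
  ext i j
  rw [conjTranspose_apply, mint_apply, mint_apply, Complex.star_def, ← integral_conj]
  refine integral_congr_ae (Eventually.of_forall fun a => ?_)
  exact (h a).apply i j

lemma trace_mul_mint {μ : Measure α} {R : α → Matrix (Fin d) (Fin d) ℂ}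
    (hI : ∀ i j, Integrable (fun a => R a i j) μ) (A : Matrix (Fin d) (Fin d) ℂ) :
    (mint μ R * A).trace.re = ∫ a, (R a * A).trace.re ∂μ := by
  have h1 : (mint μ R * A).trace = ∫ a, (R a * A).trace ∂μ := by
    simp only [Matrix.trace, Matrix.diag, Matrix.mul_apply, mint_apply]
    rw [integral_finsetSum]
    · refine Finset.sum_congr rfl fun i _ => ?_
      rw [integral_finsetSum]
      · refine Finset.sum_congr rfl fun j _ => ?_
        rw [integral_mul_const]
      · exact fun j _ => (hI i j).mul_const _
    · intro i _
      exact integrable_finsetSum _ fun j _ => (hI i j).mul_const _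
  have hc : Integrable (fun a => (R a * A).trace) μ := by
    simp only [Matrix.trace, Matrix.diag, Matrix.mul_apply]
    exact integrable_finsetSum _ fun i _ => integrable_finsetSum _ fun j _ => (hI i j).mul_const _
  rw [h1]
  have := integral_re hc
  simpa using this.symm

lemma integrable_trace_mul {μ : Measure α} {R : α → Matrix (Fin d) (Fin d) ℂ}
    (hI : ∀ i j, Integrable (fun a => R a i j) μ) (A : Matrix (Fin d) (Fin d) ℂ) :
    Integrable (fun a => (R a * A).trace.re) μ := by
  have hc : Integrable (fun a => (R a * A).trace) μ := by
    simp only [Matrix.trace, Matrix.diag, Matrix.mul_apply]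
    exact integrable_finsetSum _ fun i _ => integrable_finsetSum _ fun j _ => (hI i j).mul_const _
  exact hc.re

lemma trace_mint {μ : Measure α} {R : α → Matrix (Fin d) (Fin d) ℂ}
    (hI : ∀ i j, Integrable (fun a => R a i j) μ) :
    (mint μ R).trace.re = ∫ a, (R a).trace.re ∂μ := by
  simpa using trace_mul_mint hI 1

lemma psd_eig {A : Matrix (Fin d) (Fin d) ℂ} (h : A.PosSemidef) (i : Fin d) :
    0 ≤ h.isHermitian.eigenvalues i := h.eigenvalues_nonneg i

lemma psd_trace {A : Matrix (Fin d) (Fin d) ℂ} (h : A.PosSemidef) : 0 ≤ A.trace.re := by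
  rw [eig_trace h.isHermitian]
  exact Finset.sum_nonneg fun i _ => psd_eig h i

lemma psd_eig_le {A : Matrix (Fin d) (Fin d) ℂ} (h : A.PosSemidef) (i : Fin d) :
    h.isHermitian.eigenvalues i ≤ A.trace.re := by
  rw [eig_trace h.isHermitian]
  exact Finset.single_le_sum (fun i _ => psd_eig h i) (Finset.mem_univ i)

lemma psd_entry {A : Matrix (Fin d) (Fin d) ℂ} (h : A.PosSemidef) (i j : Fin d) :
    ‖A i j‖ ≤ A.trace.re := by
  have hs := congrFun (congrFun (spec_eq h.isHermitian) i) j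
  rw [hs, Matrix.mul_apply, eig_trace h.isHermitian]
  refine (norm_sum_le _ _).trans (Finset.sum_le_sum fun k _ => ?_)
  rw [Matrix.mul_diagonal, conjTranspose_apply, norm_mul, norm_mul, norm_star, Complex.norm_real,
    Real.norm_of_nonneg (psd_eig h k)]
  have hu := entry_norm_bound_of_unitary (h.isHermitian.eigenvectorUnitary).2
  have h1 := hu i k
  have h2 := hu j k
  have h0 := psd_eig h k
  have n1 := norm_nonneg ((h.isHermitian.eigenvectorUnitary : Matrix (Fin d) (Fin d) ℂ) i k)
  have n2 := norm_nonneg ((h.isHermitian.eigenvectorUnitary : Matrix (Fin d) (Fin d) ℂ) j k)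
  calc _ ≤ 1 * h.isHermitian.eigenvalues k * 1 := by gcongr
    _ = _ := by ring

lemma psd_zero_of_trace {A : Matrix (Fin d) (Fin d) ℂ} (h : A.PosSemidef) (ht : A.trace.re = 0) :
    A = 0 := by
  ext i j
  have := psd_entry h i j
  rw [ht] at this
  simpa using this

lemma psd_mint {μ : Measure α} {R : α → Matrix (Fin d) (Fin d) ℂ}
    (hI : ∀ i j, Integrable (fun a => R a i j) μ) (h : ∀ a, (R a).PosSemidef) :
    (mint μ R).PosSemidef := by
  have hH : (mint μ R).IsHermitian := mint_herm fun a => (h a).isHermitian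
  refine PosSemidef.of_dotProduct_mulVec_nonneg hH fun v => ?_
  have e : ∀ A : Matrix (Fin d) (Fin d) ℂ, star v ⬝ᵥ A *ᵥ v = (A * vecMulVec v (star v)).trace := by
    intro A
    rw [Matrix.mul_vecMulVec, Matrix.trace_vecMulVec, dotProduct_comm]
  have him : ∀ A : Matrix (Fin d) (Fin d) ℂ, A.IsHermitian → (star v ⬝ᵥ A *ᵥ v).im = 0 :=
    fun A hA => by simpa using hA.im_star_dotProduct_mulVec_self v
  rw [Complex.le_def]
  refine ⟨?_, by rw [him _ hH]; simp⟩
  rw [e, trace_mul_mint hI]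
  refine integral_nonneg fun a => ?_
  have := (h a).dotProduct_mulVec_nonneg v
  rw [Complex.le_def, e] at this
  exact this.1

lemma integrable_entry {μ : Measure α} {R : α → Matrix (Fin d) (Fin d) ℂ}
    (hm : ∀ i j, Measurable (fun a => R a i j)) (h : ∀ a, (R a).PosSemidef)
    (ht : Integrable (fun a => (R a).trace.re) μ) (i j : Fin d) :
    Integrable (fun a => R a i j) μ := by
  refine ht.mono (hm i j).aestronglyMeasurable (Eventually.of_forall fun a => ?_)
  rw [Real.norm_of_nonneg (psd_trace (h a))]
  exact psd_entry (h a) i j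

lemma measurable_trace {R : α → Matrix (Fin d) (Fin d) ℂ}
    (hm : ∀ i j, Measurable (fun a => R a i j)) : Measurable (fun a => (R a).trace.re) := by
  apply Complex.measurable_re.comp
  simp only [Matrix.trace, Matrix.diag]
  exact Finset.measurable_fun_sum _ fun i _ => hm i i

lemma measurable_mul {R S : α → Matrix (Fin d) (Fin d) ℂ}
    (hR : ∀ i j, Measurable (fun a => R a i j)) (hS : ∀ i j, Measurable (fun a => S a i j)) :
    ∀ i j, Measurable (fun a => (R a * S a) i j) := by
  intro i j
  simp only [Matrix.mul_apply]
  exact Finset.measurable_fun_sum _ fun k _ => (hR i k).mul (hS k j)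

/-- measurability of the functional calculus -/
def MF (R : α → Matrix (Fin d) (Fin d) ℂ) (f : ℝ → ℝ) : Prop :=
  ∀ i j, Measurable (fun a => mfun f (R a) i j)

lemma mfun_add (f g : ℝ → ℝ) {A : Matrix (Fin d) (Fin d) ℂ} (h : A.IsHermitian) :
    mfun (fun x => f x + g x) A = mfun f A + mfun g A := by
  rw [mfun_of _ h, mfun_of _ h, mfun_of _ h, ← add_mul, ← mul_add, diagonal_add]
  simp

lemma mfun_mul (f g : ℝ → ℝ) {A : Matrix (Fin d) (Fin d) ℂ} (h : A.IsHermitian) :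
    mfun (fun x => f x * g x) A = mfun f A * mfun g A := by
  rw [mfun_of _ h, mfun_of _ h, mfun_of _ h]
  set U := (h.eigenvectorUnitary : Matrix (Fin d) (Fin d) ℂ)
  have hU : ∀ Z, Uᴴ * (U * Z) = Z := fun Z => by rw [← mul_assoc, eu_left h, one_mul]
  simp only [mul_assoc, hU]
  rw [← mul_assoc (diagonal _) (diagonal _), diagonal_mul_diagonal]
  simp

lemma mfun_const (c : ℝ) {A : Matrix (Fin d) (Fin d) ℂ} (h : A.IsHermitian) :
    mfun (fun _ => c) A = (c : ℂ) • (1 : Matrix (Fin d) (Fin d) ℂ) := by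
  rw [mfun_of _ h, ← Matrix.smul_one_eq_diagonal]
  simp [eu_right h]

lemma mfun_tendsto {f : ℕ → ℝ → ℝ} {g : ℝ → ℝ} (hf : ∀ x, Tendsto (fun n => f n x) atTop (𝓝 (g x)))
    {A : Matrix (Fin d) (Fin d) ℂ} (h : A.IsHermitian) (i j : Fin d) :
    Tendsto (fun n => mfun (f n) A i j) atTop (𝓝 (mfun g A i j)) := by
  have e : ∀ φ : ℝ → ℝ, mfun φ A i j = ∑ k, (h.eigenvectorUnitary : Matrix (Fin d) (Fin d) ℂ) i k *
      ((φ (h.eigenvalues k) : ℝ) : ℂ) *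
      ((h.eigenvectorUnitary : Matrix (Fin d) (Fin d) ℂ)ᴴ) k j := by
    intro φ
    rw [mfun_of φ h, Matrix.mul_apply]
    simp_rw [Matrix.mul_diagonal]
  simp_rw [e]
  refine tendsto_finsetSum _ fun k _ => ?_
  refine Tendsto.mul_const _ (Tendsto.const_mul _ ?_)
  exact (Complex.continuous_ofReal.tendsto _).comp (hf _)

lemma MF_tendsto {R : α → Matrix (Fin d) (Fin d) ℂ} (hH : ∀ a, (R a).IsHermitian)
    {f : ℕ → ℝ → ℝ} {g : ℝ → ℝ} (hf : ∀ x, Tendsto (fun n => f n x) atTop (𝓝 (g x)))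
    (hm : ∀ n, MF R (f n)) : MF R g := by
  intro i j
  refine measurable_of_tendsto_metrizable (fun n => hm n i j) ?_
  rw [tendsto_pi_nhds]
  exact fun a => mfun_tendsto hf (hH a) i j

lemma MF_poly {R : α → Matrix (Fin d) (Fin d) ℂ} (hH : ∀ a, (R a).IsHermitian)
    (hR : ∀ i j, Measurable (fun a => R a i j)) (P : Polynomial ℝ) : MF R (fun x => P.eval x) := by
  induction P using Polynomial.induction_on' with
  | add p q hp hq =>
    intro i j
    simp only [Polynomial.eval_add]
    simp_rw [fun a => mfun_add (fun x => p.eval x) (fun x => q.eval x) (hH a)]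
    exact (hp i j).add (hq i j)
  | monomial n c =>
    induction n with
    | zero =>
      intro i j
      simp only [Polynomial.monomial_zero_left, Polynomial.eval_C]
      simp_rw [fun a => mfun_const c (hH a)]
      exact measurable_const
    | succ n ih =>
      intro i j
      simp only [Polynomial.eval_monomial] at ih ⊢
      simp_rw [pow_succ, ← mul_assoc]
      simp_rw [fun a => mfun_mul (fun x => c * x ^ n) (fun x => x) (hH a), fun a => mfun_id (hH a)]
      exact measurable_mul ih hR i j

lemma MF_cont {R : α → Matrix (Fin d) (Fin d) ℂ} (hH : ∀ a, (R a).IsHermitian)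
    (hR : ∀ i j, Measurable (fun a => R a i j)) {f : ℝ → ℝ} (hf : Continuous f) : MF R f := by
  have hP : ∀ n : ℕ, ∃ P : Polynomial ℝ, ∀ x ∈ Set.Icc (-(n:ℝ)) n,
      |P.eval x - f x| < 1 / ((n:ℝ) + 1) := fun n =>
    exists_polynomial_near_of_continuousOn _ _ f hf.continuousOn _ (by positivity)
  choose P hP using hP
  refine MF_tendsto hH (f := fun n x => (P n).eval x) (fun x => ?_) (fun n => MF_poly hH hR _)
  rw [tendsto_iff_norm_sub_tendsto_zero]
  refine squeeze_zero' (Eventually.of_forall fun n => norm_nonneg _) ?_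
    (tendsto_one_div_add_atTop_nhds_zero_nat (𝕜 := ℝ))
  obtain ⟨N, hN⟩ := exists_nat_ge |x|
  filter_upwards [eventually_ge_atTop N] with n hn
  have : |x| ≤ n := hN.trans (by exact_mod_cast hn)
  exact (hP n x (abs_le.1 this)).le

lemma MF_log {R : α → Matrix (Fin d) (Fin d) ℂ} (hH : ∀ a, (R a).IsHermitian)
    (hR : ∀ i j, Measurable (fun a => R a i j)) : MF R Real.log := by
  refine MF_tendsto hH (f := fun n x => (x * Real.log x) * (x / (x ^ 2 + 1 / ((n:ℝ) + 1))))
    (fun x => ?_) (fun n => MF_cont hH hR ?_)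
  · rcases eq_or_ne x 0 with h | h
    · subst h; simp
    · have h1 : Tendsto (fun n : ℕ => (x * Real.log x) * (x / (x ^ 2 + 1 / ((n:ℝ) + 1)))) atTop
          (𝓝 ((x * Real.log x) * (x / (x ^ 2 + 0)))) := by
        refine Tendsto.const_mul _ (Tendsto.div tendsto_const_nhds (Tendsto.add tendsto_const_nhds
          (tendsto_one_div_add_atTop_nhds_zero_nat (𝕜 := ℝ))) (by simpa using h))
      convert h1 using 2
      field_simp
      ring
  · refine Real.continuous_mul_log.mul (continuous_id.div (by fun_prop) fun x => ?_)
    positivity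

lemma measurable_vnEnt {R : α → Matrix (Fin d) (Fin d) ℂ} (hH : ∀ a, (R a).IsHermitian)
    (hR : ∀ i j, Measurable (fun a => R a i j)) : Measurable (fun a => vnEnt (R a)) := by
  simp_rw [fun a => vnEnt_eq_tr (hH a)]
  exact (measurable_trace (measurable_mul hR (MF_log hH hR))).neg

/-- PSD with lower bound on the spectrum proportional to the trace -/
def LB (δ : ℝ) (A : Matrix (Fin d) (Fin d) ℂ) : Prop :=
  A.PosSemidef ∧ (A - ((δ * A.trace.re : ℝ) : ℂ) • (1 : Matrix (Fin d) (Fin d) ℂ)).PosSemidef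

lemma psd_shift_eig {A : Matrix (Fin d) (Fin d) ℂ} (h : A.IsHermitian) (c : ℝ)
    (hc : (A - (c : ℂ) • (1 : Matrix (Fin d) (Fin d) ℂ)).PosSemidef) (i : Fin d) :
    c ≤ h.eigenvalues i := by
  set U := (h.eigenvectorUnitary : Matrix (Fin d) (Fin d) ℂ) with hU
  have h1 := hc.conjTranspose_mul_mul_same U
  have hl : Uᴴ * U = 1 := eu_left h
  have hU' : ∀ Z, Uᴴ * (U * Z) = Z := fun Z => by rw [← mul_assoc, hl, one_mul]
  have h2 : Uᴴ * (A - (c : ℂ) • (1 : Matrix (Fin d) (Fin d) ℂ)) * U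
     = diagonal (fun i => ((h.eigenvalues i - c : ℝ) : ℂ)) := by
    have hA : Uᴴ * A * U = diagonal (fun i => ((h.eigenvalues i : ℝ) : ℂ)) := by
      have := spec_eq h
      rw [← hU] at this
      calc Uᴴ * A * U = Uᴴ * (U * diagonal (fun i => ((h.eigenvalues i : ℝ) : ℂ)) * Uᴴ)
            * U := by rw [← this]
        _ = _ := by simp only [mul_assoc, hU', hl, mul_one]
    rw [mul_sub, sub_mul, hA, Matrix.mul_smul, Matrix.smul_mul, mul_one, hl,
      Matrix.smul_one_eq_diagonal, diagonal_sub]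
    simp
  rw [h2, posSemidef_diagonal_iff] at h1
  have := h1 i
  rw [Complex.zero_le_real] at this
  linarith

lemma LB.eig {δ : ℝ} {A : Matrix (Fin d) (Fin d) ℂ} (h : LB δ A) (i : Fin d) :
    δ * A.trace.re ≤ h.1.isHermitian.eigenvalues i :=
  psd_shift_eig h.1.isHermitian _ h.2 i

lemma LB.mint {δ : ℝ} {μ : Measure α} {R : α → Matrix (Fin d) (Fin d) ℂ}
    (hI : ∀ i j, Integrable (fun a => R a i j) μ) (h : ∀ a, LB δ (R a)) : LB δ (mint μ R) := by
  refine ⟨psd_mint hI fun a => (h a).1, ?_⟩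
  have hT : Integrable (fun a => (R a).trace.re) μ := by
    simpa using integrable_trace_mul hI 1
  have e : ∀ i j, (fun a => (R a - ((δ * (R a).trace.re : ℝ) : ℂ) •
      (1 : Matrix (Fin d) (Fin d) ℂ)) i j) = fun a => R a i j - ((δ * (R a).trace.re : ℝ) : ℂ) *
      (1 : Matrix (Fin d) (Fin d) ℂ) i j := fun i j => by ext a; simp
  have hI2 : ∀ i j, Integrable (fun a => ((δ * (R a).trace.re : ℝ) : ℂ) *
      (1 : Matrix (Fin d) (Fin d) ℂ) i j) μ := fun i j => (hT.const_mul δ).ofReal.mul_const _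
  have := psd_mint (μ := μ) (R := fun a => R a - ((δ * (R a).trace.re : ℝ) : ℂ) •
      (1 : Matrix (Fin d) (Fin d) ℂ)) (fun i j => by rw [e]; exact (hI i j).sub (hI2 i j))
      (fun a => (h a).2)
  convert this using 1
  ext i j
  rw [mint_apply, e, integral_sub (hI i j) (hI2 i j), integral_mul_const, integral_complex_ofReal,
    integral_const_mul, ← trace_mint hI]
  simp [mint_apply]

lemma cross_bound {δ : ℝ} (hδ : 0 < δ) {A B : Matrix (Fin d) (Fin d) ℂ} (hA : A.PosSemidef)
    (hB : LB δ B) : |(A * mfun Real.log B).trace.re|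
      ≤ A.trace.re * (|Real.log B.trace.re| + |Real.log δ|) := by
  rw [tr_mfun _ hA.isHermitian hB.1.isHermitian]
  have hl : ∀ j, |Real.log (hB.1.isHermitian.eigenvalues j)|
      ≤ |Real.log B.trace.re| + |Real.log δ| := by
    intro j
    have h1 := hB.eig j
    have h2 := psd_eig_le hB.1 j
    rcases eq_or_lt_of_le (psd_trace hB.1) with h | h
    · have h5 : δ * B.trace.re = 0 := by rw [← h, mul_zero]
      have : hB.1.isHermitian.eigenvalues j = 0 := by linarith
      rw [this, Real.log_zero, abs_zero]; positivity
    · have h3 := Real.log_le_log (by positivity) h1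
      rw [Real.log_mul hδ.ne' h.ne'] at h3
      have h4 := Real.log_le_log (lt_of_lt_of_le (by positivity) h1) h2
      rw [abs_le]
      constructor
      · linarith [neg_abs_le (Real.log B.trace.re), neg_abs_le (Real.log δ)]
      · linarith [le_abs_self (Real.log B.trace.re), abs_nonneg (Real.log δ)]
  rw [eig_trace hA.isHermitian, Finset.sum_mul]
  refine (Finset.abs_sum_le_sum_abs _ _).trans (Finset.sum_le_sum fun i _ => ?_)
  refine (Finset.abs_sum_le_sum_abs _ _).trans ?_
  calc _ ≤ ∑ j, Complex.normSq (ovl hA.isHermitian hB.1.isHermitian i j) *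
        (hA.isHermitian.eigenvalues i * (|Real.log B.trace.re| + |Real.log δ|)) := by
        refine Finset.sum_le_sum fun j _ => ?_
        rw [abs_mul, abs_mul, abs_of_nonneg (Complex.normSq_nonneg _), abs_of_nonneg (psd_eig hA i)]
        exact mul_le_mul_of_nonneg_left (mul_le_mul_of_nonneg_left (hl j) (psd_eig hA i))
          (Complex.normSq_nonneg _)
    _ = _ := by rw [← Finset.sum_mul, ovl_row, one_mul]

end MeasMatrix

section SSA
open Matrix

variable {d : ℕ} {α β γ : Type*} [MeasurableSpace α] [MeasurableSpace β] [MeasurableSpace γ]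

lemma mint_meas_right {ν : Measure γ} [SFinite ν] {R : β × γ → Matrix (Fin d) (Fin d) ℂ}
    (hm : ∀ i j, Measurable (fun x => R x i j)) (i j : Fin d) :
    Measurable (fun b => mint ν (fun c => R (b, c)) i j) :=
  ((hm i j).stronglyMeasurable.integral_prod_right' (ν := ν)).measurable

lemma mint_meas_left {μ : Measure β} [SFinite μ] {R : β × γ → Matrix (Fin d) (Fin d) ℂ}
    (hm : ∀ i j, Measurable (fun x => R x i j)) (i j : Fin d) :
    Measurable (fun c => mint μ (fun b => R (b, c)) i j) :=
  ((hm i j).stronglyMeasurable.integral_prod_left' (μ := μ)).measurable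

lemma mint_prod_right {μ : Measure β} {ν : Measure γ} [SFinite μ] [SFinite ν]
    {R : β × γ → Matrix (Fin d) (Fin d) ℂ}
    (hI : ∀ i j, Integrable (fun x => R x i j) (μ.prod ν)) :
    mint μ (fun b => mint ν (fun c => R (b, c))) = mint (μ.prod ν) R := by
  ext i j
  simp only [mint_apply]
  exact (integral_prod _ (hI i j)).symm

lemma mint_prod_left {μ : Measure β} {ν : Measure γ} [SFinite μ] [SFinite ν]
    {R : β × γ → Matrix (Fin d) (Fin d) ℂ}
    (hI : ∀ i j, Integrable (fun x => R x i j) (μ.prod ν)) :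
    mint ν (fun c => mint μ (fun b => R (b, c))) = mint (μ.prod ν) R := by
  ext i j
  simp only [mint_apply]
  exact (integral_prod_symm _ (hI i j)).symm

lemma slice_right {μ : Measure β} {ν : Measure γ} [SFinite μ] [SFinite ν]
    {R : β × γ → Matrix (Fin d) (Fin d) ℂ}
    (hI : ∀ i j, Integrable (fun x => R x i j) (μ.prod ν)) :
    ∀ᵐ b ∂μ, ∀ i j, Integrable (fun c => R (b, c) i j) ν := by
  simp only [ae_all_iff]
  exact fun i j => (hI i j).prod_right_ae

lemma slice_left {μ : Measure β} {ν : Measure γ} [SFinite μ] [SFinite ν]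
    {R : β × γ → Matrix (Fin d) (Fin d) ℂ}
    (hI : ∀ i j, Integrable (fun x => R x i j) (μ.prod ν)) :
    ∀ᵐ c ∂ν, ∀ i j, Integrable (fun b => R (b, c) i j) μ := by
  simp only [ae_all_iff]
  exact fun i j => (hI i j).prod_left_ae

lemma vnEnt_LB_bound {δ : ℝ} (hδ : 0 < δ) {A : Matrix (Fin d) (Fin d) ℂ} (h : LB δ A) :
    |vnEnt A| ≤ |A.trace.re * Real.log A.trace.re| + A.trace.re * |Real.log δ| := by
  have := cross_bound hδ h.1 h
  rw [vnEnt_eq_tr h.1.isHermitian, abs_neg, abs_mul, abs_of_nonneg (psd_trace h.1)]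
  linarith

lemma integrable_vnEnt_LB {δ : ℝ} (hδ : 0 < δ) {μ : Measure α}
    {R : α → Matrix (Fin d) (Fin d) ℂ} (hm : ∀ i j, Measurable (fun a => R a i j))
    (hH : ∀ a, (R a).IsHermitian) (h : ∀ᵐ a ∂μ, LB δ (R a))
    (ht : Integrable (fun a => (R a).trace.re) μ)
    (htl : Integrable (fun a => (R a).trace.re * Real.log (R a).trace.re) μ) :
    Integrable (fun a => vnEnt (R a)) μ := by
  refine (htl.abs.add (ht.mul_const |Real.log δ|)).mono'
    (measurable_vnEnt hH hm).aestronglyMeasurable ?_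
  filter_upwards [h] with a ha
  exact vnEnt_LB_bound hδ ha

lemma relEnt_zero (B : Matrix (Fin d) (Fin d) ℂ) : relEnt 0 B = 0 := by
  unfold relEnt; rw [vnEnt_zero]; simp

set_option maxHeartbeats 1000000 in
theorem ssa_delta {δ : ℝ} (hδ : 0 < δ) (μ : Measure β) (ν : Measure γ) [SFinite μ] [SFinite ν]
    (R : β × γ → Matrix (Fin d) (Fin d) ℂ) (hm : ∀ i j, Measurable (fun x => R x i j))
    (hLB : ∀ x, LB δ (R x))
    (hp : Integrable (fun x => (R x).trace.re) (μ.prod ν))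
    (hpl : Integrable (fun x => (R x).trace.re * Real.log (R x).trace.re) (μ.prod ν))
    (h1l : Integrable (fun b => (mint ν (fun c => R (b, c))).trace.re *
      Real.log (mint ν (fun c => R (b, c))).trace.re) μ)
    (h2l : Integrable (fun c => (mint μ (fun b => R (b, c))).trace.re *
      Real.log (mint μ (fun b => R (b, c))).trace.re) ν)
    (hT : 0 < (mint (μ.prod ν) R).trace.re) :
    ∫ x, vnEnt (R x) ∂(μ.prod ν) + vnEnt (mint (μ.prod ν) R)
      ≤ ∫ b, vnEnt (mint ν (fun c => R (b, c))) ∂μ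
        + ∫ c, vnEnt (mint μ (fun b => R (b, c))) ∂ν := by
  have hI := integrable_entry hm (fun x => (hLB x).1) hp
  set R1 : β → Matrix (Fin d) (Fin d) ℂ := fun b => mint ν (fun c => R (b, c)) with hR1
  set R2 : γ → Matrix (Fin d) (Fin d) ℂ := fun c => mint μ (fun b => R (b, c)) with hR2
  set T := mint (μ.prod ν) R with hTdef
  change ∫ x, vnEnt (R x) ∂(μ.prod ν) + vnEnt T ≤ ∫ b, vnEnt (R1 b) ∂μ + ∫ c, vnEnt (R2 c) ∂ν
  have hm1 : ∀ i j, Measurable (fun b => R1 b i j) := mint_meas_right hm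
  have hm2 : ∀ i j, Measurable (fun c => R2 c i j) := mint_meas_left hm
  have hH1 : ∀ b, (R1 b).IsHermitian := fun b => mint_herm fun c => (hLB _).1.isHermitian
  have hH2 : ∀ c, (R2 c).IsHermitian := fun c => mint_herm fun b => (hLB _).1.isHermitian
  have hI1 : ∀ i j, Integrable (fun b => R1 b i j) μ := fun i j => (hI i j).integral_prod_left
  have hI2 : ∀ i j, Integrable (fun c => R2 c i j) ν := fun i j => (hI i j).integral_prod_right
  have hT1 : mint μ R1 = T := mint_prod_right hI
  have hT2 : mint ν R2 = T := mint_prod_left hI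
  have hs1 := slice_right hI
  have hs2 := slice_left hI
  have hLB1 : ∀ᵐ b ∂μ, LB δ (R1 b) := by
    filter_upwards [hs1] with b hb using LB.mint hb fun c => hLB _
  have hLB2 : ∀ᵐ c ∂ν, LB δ (R2 c) := by
    filter_upwards [hs2] with c hc using LB.mint hc fun b => hLB _
  have hLBT : LB δ T := LB.mint hI hLB
  have hp1 : Integrable (fun b => (R1 b).trace.re) μ := by
    simpa using integrable_trace_mul hI1 1
  have hp2 : Integrable (fun c => (R2 c).trace.re) ν := by
    simpa using integrable_trace_mul hI2 1
  have hE : Integrable (fun x => vnEnt (R x)) (μ.prod ν) :=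
    integrable_vnEnt_LB hδ hm (fun x => (hLB x).1.isHermitian) (Eventually.of_forall hLB) hp hpl
  have hE1 : Integrable (fun b => vnEnt (R1 b)) μ := integrable_vnEnt_LB hδ hm1 hH1 hLB1 hp1 h1l
  have hE2 : Integrable (fun c => vnEnt (R2 c)) ν := integrable_vnEnt_LB hδ hm2 hH2 hLB2 hp2 h2l
  -- the cross term
  set C : β × γ → ℝ := fun x => (R x * mfun Real.log (R1 x.1)).trace.re with hC
  have hCm : Measurable C := measurable_trace (measurable_mul hm
    (fun i j => ((MF_log hH1 hm1) i j).comp measurable_fst))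
  have hq1m : Measurable (fun b => (R1 b).trace.re) := measurable_trace hm1
  have hpq : Integrable (fun x : β × γ => (R x).trace.re * |Real.log (R1 x.1).trace.re|)
      (μ.prod ν) := by
    have hmm : Measurable (fun x : β × γ => (R x).trace.re * |Real.log (R1 x.1).trace.re|) :=
      (measurable_trace hm).mul (((hq1m.comp measurable_fst).log).abs)
    rw [integrable_prod_iff hmm.aestronglyMeasurable]
    constructor
    · filter_upwards [hp.prod_right_ae] with b hb
      exact hb.mul_const _
    · refine h1l.abs.congr ?_
      filter_upwards [hs1, hLB1] with b hb hlb
      change |(R1 b).trace.re * Real.log (R1 b).trace.re| = _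
      simp only [norm_mul, Real.norm_eq_abs, abs_abs]
      rw [integral_mul_const, abs_mul]
      congr 1
      rw [abs_of_nonneg (psd_trace hlb.1), hR1, trace_mint hb]
      refine integral_congr_ae (Eventually.of_forall fun c => ?_)
      exact (abs_of_nonneg (psd_trace (hLB _).1)).symm
  have hLB1' : ∀ᵐ x ∂(μ.prod ν), LB δ (R1 x.1) :=
    (Measure.quasiMeasurePreserving_fst (μ := μ) (ν := ν)).ae hLB1
  have hCI : Integrable C (μ.prod ν) := by
    have hg : Integrable (fun x : β × γ => (R x).trace.re *
        (|Real.log (R1 x.1).trace.re| + |Real.log δ|)) (μ.prod ν) := by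
      simp_rw [mul_add]
      exact hpq.add (hp.mul_const |Real.log δ|)
    refine hg.mono' hCm.aestronglyMeasurable ?_
    filter_upwards [hLB1'] with x hx
    rw [Real.norm_eq_abs]
    exact cross_bound hδ (hLB x).1 hx
  have hCint : ∫ x, C x ∂(μ.prod ν) = -∫ b, vnEnt (R1 b) ∂μ := by
    rw [integral_prod _ hCI, ← integral_neg]
    refine integral_congr_ae ?_
    filter_upwards [hs1] with b hb
    rw [vnEnt_eq_tr (hH1 b), neg_neg]
    have h5 := trace_mul_mint hb (mfun Real.log (R1 b))
    have h6 : mint ν (fun c => R (b, c)) = R1 b := rfl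
    rw [h6] at h5
    rw [h5]
  -- relative entropy
  set F : β × γ → ℝ := fun x => relEnt (R x) (R1 x.1) with hF
  have hFI : Integrable F (μ.prod ν) := hE.neg.sub hCI
  have hFint : ∫ x, F x ∂(μ.prod ν) = -∫ x, vnEnt (R x) ∂(μ.prod ν) + ∫ b, vnEnt (R1 b) ∂μ := by
    have : ∫ x, F x ∂(μ.prod ν) = ∫ x, (-vnEnt (R x) - C x) ∂(μ.prod ν) := rfl
    have hEn : Integrable (fun x => -vnEnt (R x)) (μ.prod ν) := hE.neg
    rw [this, integral_sub hEn hCI, integral_neg, hCint]; ring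
  have hGI : Integrable (fun c => relEnt (R2 c) T) ν :=
    hE2.neg.sub (integrable_trace_mul hI2 _)
  have hGint : ∫ c, relEnt (R2 c) T ∂ν = -∫ c, vnEnt (R2 c) ∂ν + vnEnt T := by
    have : ∫ c, relEnt (R2 c) T ∂ν
      = ∫ c, (-vnEnt (R2 c) - (R2 c * mfun Real.log T).trace.re) ∂ν := rfl
    have hEn : Integrable (fun x => -vnEnt (R2 x)) ν := hE2.neg
    rw [this, integral_sub hEn (integrable_trace_mul hI2 _), integral_neg,
      ← trace_mul_mint hI2, hT2, vnEnt_eq_tr hLBT.1.isHermitian]; ring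
  have hdich : ∀ᵐ c ∂ν, ∀ᵐ b ∂μ, (R1 b).trace.re = 0 → (R (b, c)).trace.re = 0 := by
    rw [← Measure.ae_ae_comm]
    · filter_upwards [hs1] with b hb
      by_cases hz : (R1 b).trace.re = 0
      · have hz' := hz
        rw [hR1, trace_mint hb, integral_eq_zero_iff_of_nonneg (fun c => psd_trace (hLB _).1)
          (by simpa using integrable_trace_mul hb 1)] at hz'
        filter_upwards [hz'] with c hc _ using hc
      · exact Eventually.of_forall fun c h => absurd h hz
    · have ha : MeasurableSet {x : β × γ | (R1 x.1).trace.re = 0} :=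
        (hq1m.comp measurable_fst) (measurableSet_singleton 0)
      have hb : MeasurableSet {x : β × γ | (R x).trace.re = 0} :=
        (measurable_trace hm) (measurableSet_singleton 0)
      have : {x : β × γ | (R1 x.1).trace.re = 0 → (R (x.1, x.2)).trace.re = 0}
        = {x : β × γ | (R1 x.1).trace.re = 0}ᶜ ∪ {x : β × γ | (R x).trace.re = 0} := by
        ext x; simp only [Set.mem_ofPred_eq, Set.mem_union, Set.mem_compl_iff]; tauto
      rw [this]
      exact ha.compl.union hb
  have hmain : ∀ᵐ c ∂ν, relEnt (R2 c) T ≤ ∫ b, F (b, c) ∂μ := by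
    filter_upwards [hs2, hLB2, hFI.prod_left_ae, hdich] with c hc hlb hFc hd
    rcases eq_or_lt_of_le (psd_trace hlb.1) with h0 | h0
    · have hz := psd_zero_of_trace hlb.1 h0.symm
      rw [hz, relEnt_zero]
      have hz' := h0.symm
      rw [hR2, trace_mint hc, integral_eq_zero_iff_of_nonneg (fun b => psd_trace (hLB _).1)
          (by simpa using integrable_trace_mul hc 1)] at hz'
      have : ∫ b, F (b, c) ∂μ = 0 := by
        rw [integral_eq_zero_of_ae]
        filter_upwards [hz'] with b hb
        have := psd_zero_of_trace (hLB (b, c)).1 hb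
        simp only [hF, this, relEnt_zero, Pi.zero_apply]
      rw [this]
    · obtain ⟨K, L, hKL, hKL0⟩ := relEnt_tangent hlb.1.isHermitian hLBT.1.isHermitian
        (fun i => lt_of_lt_of_le (by positivity) (hlb.eig i))
        (fun i => lt_of_lt_of_le (by positivity) (hLBT.eig i))
      rw [← hKL0, ← hT1, trace_mul_mint hI1, hR2, trace_mul_mint hc, ← integral_add
        (integrable_trace_mul hc K) (integrable_trace_mul hI1 L)]
      refine integral_mono_ae ((integrable_trace_mul hc K).add (integrable_trace_mul hI1 L)) hFc ?_
      filter_upwards [hd, hLB1] with b hb hlb1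
      rcases eq_or_lt_of_le (psd_trace hlb1.1) with g0 | g0
      · have hz1 := psd_zero_of_trace hlb1.1 g0.symm
        have hz := psd_zero_of_trace (hLB (b, c)).1 (hb g0.symm)
        simp only [hF, hz, hz1, relEnt_zero]
        simp
      · exact hKL _ _ (hLB (b, c)).1.isHermitian hlb1.1.isHermitian (psd_eig (hLB (b, c)).1)
          (fun i => lt_of_lt_of_le (by positivity) (hlb1.eig i))
  have hfin : ∫ c, relEnt (R2 c) T ∂ν ≤ ∫ c, ∫ b, F (b, c) ∂μ ∂ν :=
    integral_mono_ae hGI hFI.integral_prod_right hmain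
  rw [← integral_prod_symm _ hFI, hFint, hGint] at hfin
  linarith

end SSA

section SSAgen
open Matrix

variable {d : ℕ} {α β γ : Type*} [MeasurableSpace α] [MeasurableSpace β] [MeasurableSpace γ]

lemma negMulLog_le_one' {t : ℝ} (h0 : 0 ≤ t) : Real.negMulLog t ≤ 1 := by
  rcases eq_or_lt_of_le h0 with h | h
  · rw [← h]; simp
  · have := Real.one_sub_inv_le_log_of_pos h
    have h2 : t * (1 - t⁻¹) ≤ t * Real.log t := mul_le_mul_of_nonneg_left this h0
    rw [mul_sub, mul_inv_cancel₀ h.ne'] at h2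
    rw [Real.negMulLog]
    linarith

lemma vnEnt_negMulLog {A : Matrix (Fin d) (Fin d) ℂ} (h : A.IsHermitian) :
    vnEnt A = ∑ i, Real.negMulLog (h.eigenvalues i) := by
  rw [vnEnt_of h, ← Finset.sum_neg_distrib]
  refine Finset.sum_congr rfl fun i _ => ?_
  rw [Real.negMulLog]; ring

lemma vnEnt_scale {A : Matrix (Fin d) (Fin d) ℂ} (h : A.PosSemidef) (ht : A.trace.re ≠ 0) :
    vnEnt A = Real.negMulLog A.trace.re + A.trace.re *
      ∑ i, Real.negMulLog (h.isHermitian.eigenvalues i / A.trace.re) := by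
  rw [vnEnt_negMulLog h.isHermitian]
  set q := A.trace.re with hq
  have hq' : q = ∑ i, h.isHermitian.eigenvalues i := eig_trace h.isHermitian
  have : ∀ i, Real.negMulLog (h.isHermitian.eigenvalues i) =
      (h.isHermitian.eigenvalues i / q) * Real.negMulLog q +
       q * Real.negMulLog (h.isHermitian.eigenvalues i / q) := by
    intro i
    rw [← Real.negMulLog_mul]
    congr 1
    field_simp
  rw [Finset.sum_congr rfl fun i _ => this i, Finset.sum_add_distrib, ← Finset.sum_mul,
    ← Finset.mul_sum, ← Finset.sum_div, ← hq', div_self ht, one_mul]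

lemma vnEnt_bound {A : Matrix (Fin d) (Fin d) ℂ} (h : A.PosSemidef) :
    |vnEnt A| ≤ |A.trace.re * Real.log A.trace.re| + A.trace.re * d := by
  have h0 := psd_trace h
  rcases eq_or_lt_of_le h0 with hz | hz
  · rw [psd_zero_of_trace h hz.symm, vnEnt_zero]; simp
  · rw [vnEnt_scale h hz.ne']
    refine (abs_add_le _ _).trans ?_
    have h1 : |Real.negMulLog A.trace.re| = |A.trace.re * Real.log A.trace.re| := by
      rw [Real.negMulLog, neg_mul, abs_neg]
    rw [h1]
    have ht : ∀ i, 0 ≤ h.isHermitian.eigenvalues i / A.trace.re ∧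
        h.isHermitian.eigenvalues i / A.trace.re ≤ 1 := fun i =>
      ⟨div_nonneg (psd_eig h i) h0, div_le_one_of_le₀ (psd_eig_le h i) h0⟩
    have h2 : 0 ≤ ∑ i, Real.negMulLog (h.isHermitian.eigenvalues i / A.trace.re) :=
      Finset.sum_nonneg fun i _ => Real.negMulLog_nonneg (ht i).1 (ht i).2
    have h3 : ∑ i, Real.negMulLog (h.isHermitian.eigenvalues i / A.trace.re) ≤ d := by
      calc _ ≤ ∑ i : Fin d, (1 : ℝ) := Finset.sum_le_sum fun i _ => negMulLog_le_one' (ht i).1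
        _ = d := by simp
    rw [abs_of_nonneg (mul_nonneg h0 h2)]
    gcongr

lemma integrable_vnEnt {μ : Measure α}
    {R : α → Matrix (Fin d) (Fin d) ℂ} (hm : ∀ i j, Measurable (fun a => R a i j))
    (hH : ∀ a, (R a).IsHermitian) (h : ∀ᵐ a ∂μ, (R a).PosSemidef)
    (ht : Integrable (fun a => (R a).trace.re) μ)
    (htl : Integrable (fun a => (R a).trace.re * Real.log (R a).trace.re) μ) :
    Integrable (fun a => vnEnt (R a)) μ := by
  refine (htl.abs.add (ht.mul_const (d : ℝ))).mono'
    (measurable_vnEnt hH hm).aestronglyMeasurable ?_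
  filter_upwards [h] with a ha
  exact vnEnt_bound ha

/-- depolarisation -/
def dep (ε : ℝ) (A : Matrix (Fin d) (Fin d) ℂ) : Matrix (Fin d) (Fin d) ℂ :=
  ((1 - ε : ℝ) : ℂ) • A + ((ε / d * A.trace.re : ℝ) : ℂ) • (1 : Matrix (Fin d) (Fin d) ℂ)

lemma dep_trace (hd : 0 < d) (ε : ℝ) (A : Matrix (Fin d) (Fin d) ℂ) :
    (dep ε A).trace.re = A.trace.re := by
  have hd' : (d : ℝ) ≠ 0 := by exact_mod_cast hd.ne'
  unfold dep
  rw [trace_add, trace_smul, trace_smul, trace_one]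
  simp only [smul_eq_mul, Complex.add_re, Complex.re_ofReal_mul, Fintype.card_fin,
    Complex.natCast_re]
  field_simp
  ring

lemma dep_LB (hd : 0 < d) {ε : ℝ} (h0 : 0 ≤ ε) (h1 : ε ≤ 1) {A : Matrix (Fin d) (Fin d) ℂ}
    (hA : A.PosSemidef) : LB (ε / d) (dep ε A) := by
  have h2 : (((1 - ε : ℝ) : ℂ) • A).PosSemidef := by
    refine hA.smul ?_
    rw [Complex.zero_le_real]; linarith
  constructor
  · refine h2.add (PosSemidef.one.smul ?_)
    rw [Complex.zero_le_real]
    have := psd_trace hA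
    positivity
  · rw [dep_trace hd]
    unfold dep
    rw [add_sub_cancel_right]
    exact h2

lemma dep_vnEnt {ε : ℝ} {A : Matrix (Fin d) (Fin d) ℂ}
    (hA : A.IsHermitian) (hD : (dep ε A).IsHermitian) :
    vnEnt (dep ε A) = ∑ i, Real.negMulLog ((1 - ε) * hA.eigenvalues i + ε / d * A.trace.re) := by
  rw [vnEnt_negMulLog hD]
  refine eig_sum_of_diag Real.negMulLog hD (eu_left hA)
    (fun i => (1 - ε) * hA.eigenvalues i + ε / d * A.trace.re) ?_
  have h1 : diagonal (fun i => (((1 - ε) * hA.eigenvalues i + ε / d * A.trace.re : ℝ) : ℂ)) =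
     ((1 - ε : ℝ) : ℂ) • diagonal (fun i => ((hA.eigenvalues i : ℝ) : ℂ)) +
      ((ε / d * A.trace.re : ℝ) : ℂ) • (1 : Matrix (Fin d) (Fin d) ℂ) := by
    rw [Matrix.smul_one_eq_diagonal, ← diagonal_smul, diagonal_add]
    congr 1
    ext i
    simp
  rw [h1, mul_add, add_mul, Matrix.mul_smul, Matrix.smul_mul, ← spec_eq hA, Matrix.mul_smul,
    Matrix.smul_mul, mul_one, eu_right hA]
  rfl

lemma dep_tendsto (hd : 0 < d) {A : Matrix (Fin d) (Fin d) ℂ} (hA : A.PosSemidef) :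
    Tendsto (fun k : ℕ => vnEnt (dep (1 / ((k : ℝ) + 1)) A)) atTop (𝓝 (vnEnt A)) := by
  have h1 : ∀ k : ℕ, vnEnt (dep (1 / ((k : ℝ) + 1)) A) = ∑ i, Real.negMulLog
      ((1 - 1 / ((k : ℝ) + 1)) * hA.isHermitian.eigenvalues i +
        (1 / ((k : ℝ) + 1)) / d * A.trace.re) := by
    intro k
    refine dep_vnEnt hA.isHermitian (dep_LB hd (by positivity) ?_ hA).1.isHermitian
    rw [div_le_one (by positivity)]
    linarith [(Nat.cast_nonneg k : (0:ℝ) ≤ k)]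
  simp_rw [h1]
  rw [vnEnt_negMulLog hA.isHermitian]
  refine tendsto_finsetSum _ fun i _ => ?_
  refine (Real.continuous_negMulLog.tendsto _).comp ?_
  have h2 := tendsto_one_div_add_atTop_nhds_zero_nat (𝕜 := ℝ)
  have h3 := ((tendsto_const_nhds (x := (1:ℝ))).sub h2).mul_const (hA.isHermitian.eigenvalues i)
  have h4 := (h2.div_const (d:ℝ)).mul_const A.trace.re
  simpa using h3.add h4

lemma dep_mint {μ : Measure α} {R : α → Matrix (Fin d) (Fin d) ℂ}
    (hI : ∀ i j, Integrable (fun a => R a i j) μ) (ε : ℝ) :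
    mint μ (fun a => dep ε (R a)) = dep ε (mint μ R) := by
  have hT : Integrable (fun a => (R a).trace.re) μ := by
    simpa using integrable_trace_mul hI 1
  ext i j
  have e : ∀ A : Matrix (Fin d) (Fin d) ℂ, dep ε A i j = ((1 - ε : ℝ) : ℂ) * A i j +
    ((ε / d * A.trace.re : ℝ) : ℂ) * (1 : Matrix (Fin d) (Fin d) ℂ) i j := by
    intro A; simp [dep]
  have hI2 : Integrable (fun a => ((ε / d * (R a).trace.re : ℝ) : ℂ) *
      (1 : Matrix (Fin d) (Fin d) ℂ) i j) μ := (hT.const_mul (ε / d)).ofReal.mul_const _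
  rw [mint_apply]
  simp_rw [e]
  rw [integral_add ((hI i j).const_mul _) hI2, integral_const_mul, integral_mul_const,
    integral_complex_ofReal, integral_const_mul, ← trace_mint hI, mint_apply]

lemma dep_meas {R : α → Matrix (Fin d) (Fin d) ℂ}
    (hm : ∀ i j, Measurable (fun x => R x i j)) (ε : ℝ) (i j : Fin d) :
    Measurable (fun a => dep ε (R a) i j) := by
  have e : ∀ A : Matrix (Fin d) (Fin d) ℂ, dep ε A i j = ((1 - ε : ℝ) : ℂ) * A i j +
    ((ε / d * A.trace.re : ℝ) : ℂ) * (1 : Matrix (Fin d) (Fin d) ℂ) i j := by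
    intro A; simp [dep]
  simp_rw [e]
  exact ((hm i j).const_mul _).add
    ((Complex.measurable_ofReal.comp ((measurable_trace hm).const_mul _)).mul_const _)

lemma dep_herm {ε : ℝ} {A : Matrix (Fin d) (Fin d) ℂ} (hA : A.IsHermitian) :
    (dep ε A).IsHermitian := by
  unfold dep
  refine IsHermitian.add ?_ ?_
  · rw [IsHermitian, conjTranspose_smul, hA.eq, Complex.star_def, Complex.conj_ofReal]
  · rw [IsHermitian, conjTranspose_smul, conjTranspose_one, Complex.star_def, Complex.conj_ofReal]

lemma dep_int_tendsto (hd : 0 < d) {μ : Measure α}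
    {R : α → Matrix (Fin d) (Fin d) ℂ} (hm : ∀ i j, Measurable (fun a => R a i j))
    (hH : ∀ a, (R a).IsHermitian) (h : ∀ᵐ a ∂μ, (R a).PosSemidef)
    (ht : Integrable (fun a => (R a).trace.re) μ)
    (htl : Integrable (fun a => (R a).trace.re * Real.log (R a).trace.re) μ) :
    Tendsto (fun k : ℕ => ∫ a, vnEnt (dep (1 / ((k : ℝ) + 1)) (R a)) ∂μ) atTop
      (𝓝 (∫ a, vnEnt (R a) ∂μ)) := by
  refine tendsto_integral_of_dominated_convergence
    (fun a => |(R a).trace.re * Real.log (R a).trace.re| + (R a).trace.re * d) ?_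
    (htl.abs.add (ht.mul_const (d : ℝ))) ?_ ?_
  · intro k
    exact (measurable_vnEnt (fun a => dep_herm (hH a)) (dep_meas hm _)).aestronglyMeasurable
  · intro k
    filter_upwards [h] with a ha
    have h1 : 1 / ((k : ℝ) + 1) ≤ 1 := by
      rw [div_le_one (by positivity)]
      linarith [(Nat.cast_nonneg k : (0:ℝ) ≤ k)]
    have := vnEnt_bound (dep_LB hd (ε := 1 / ((k : ℝ) + 1)) (by positivity) h1 ha).1
    rw [dep_trace hd] at this
    exact this
  · filter_upwards [h] with a ha
    exact dep_tendsto hd ha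

set_option maxHeartbeats 1000000 in
theorem ssa (μ : Measure β) (ν : Measure γ) [SFinite μ] [SFinite ν]
    (R : β × γ → Matrix (Fin d) (Fin d) ℂ) (hm : ∀ i j, Measurable (fun x => R x i j))
    (hP : ∀ x, (R x).PosSemidef)
    (hp : Integrable (fun x => (R x).trace.re) (μ.prod ν))
    (hpl : Integrable (fun x => (R x).trace.re * Real.log (R x).trace.re) (μ.prod ν))
    (h1l : Integrable (fun b => (mint ν (fun c => R (b, c))).trace.re *
      Real.log (mint ν (fun c => R (b, c))).trace.re) μ)
    (h2l : Integrable (fun c => (mint μ (fun b => R (b, c))).trace.re *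
      Real.log (mint μ (fun b => R (b, c))).trace.re) ν) :
    ∫ x, vnEnt (R x) ∂(μ.prod ν) + vnEnt (mint (μ.prod ν) R)
      ≤ ∫ b, vnEnt (mint ν (fun c => R (b, c))) ∂μ
        + ∫ c, vnEnt (mint μ (fun b => R (b, c))) ∂ν := by
  have hI := integrable_entry hm hP hp
  have hPT : (mint (μ.prod ν) R).PosSemidef := psd_mint hI hP
  have hm1 := mint_meas_right (ν := ν) hm
  have hm2 := mint_meas_left (μ := μ) hm
  have hH1 : ∀ b, (mint ν (fun c => R (b, c))).IsHermitian :=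
    fun b => mint_herm fun c => (hP _).isHermitian
  have hH2 : ∀ c, (mint μ (fun b => R (b, c))).IsHermitian :=
    fun c => mint_herm fun b => (hP _).isHermitian
  have hI1 : ∀ i j, Integrable (fun b => mint ν (fun c => R (b, c)) i j) μ :=
    fun i j => (hI i j).integral_prod_left
  have hI2 : ∀ i j, Integrable (fun c => mint μ (fun b => R (b, c)) i j) ν :=
    fun i j => (hI i j).integral_prod_right
  have hs1 := slice_right hI
  have hs2 := slice_left hI
  have hP1 : ∀ᵐ b ∂μ, (mint ν (fun c => R (b, c))).PosSemidef := by
    filter_upwards [hs1] with b hb using psd_mint hb fun c => hP _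
  have hP2 : ∀ᵐ c ∂ν, (mint μ (fun b => R (b, c))).PosSemidef := by
    filter_upwards [hs2] with c hc using psd_mint hc fun b => hP _
  have hp1 : Integrable (fun b => (mint ν (fun c => R (b, c))).trace.re) μ := by
    simpa using integrable_trace_mul hI1 1
  have hp2 : Integrable (fun c => (mint μ (fun b => R (b, c))).trace.re) ν := by
    simpa using integrable_trace_mul hI2 1
  have hT1 : mint μ (fun b => mint ν (fun c => R (b, c))) = mint (μ.prod ν) R := mint_prod_right hI
  have hT2 : mint ν (fun c => mint μ (fun b => R (b, c))) = mint (μ.prod ν) R := mint_prod_left hI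
  rcases eq_or_lt_of_le (psd_trace hPT) with h0 | h0
  · have e0 : ∫ x, vnEnt (R x) ∂(μ.prod ν) = 0 := by
      apply integral_eq_zero_of_ae
      have hz := h0.symm
      rw [trace_mint hI, integral_eq_zero_iff_of_nonneg (fun x => psd_trace (hP x)) hp] at hz
      filter_upwards [hz] with x hx
      rw [psd_zero_of_trace (hP x) hx, vnEnt_zero]; rfl
    have e1 : ∫ b, vnEnt (mint ν (fun c => R (b, c))) ∂μ = 0 := by
      apply integral_eq_zero_of_ae
      have hz := h0.symm
      rw [← hT1, trace_mint hI1, integral_eq_zero_iff_of_nonneg_ae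
        (by filter_upwards [hP1] with b hb using psd_trace hb) hp1] at hz
      filter_upwards [hz, hP1] with x hx hpx
      rw [psd_zero_of_trace hpx hx, vnEnt_zero]; rfl
    have e2 : ∫ c, vnEnt (mint μ (fun b => R (b, c))) ∂ν = 0 := by
      apply integral_eq_zero_of_ae
      have hz := h0.symm
      rw [← hT2, trace_mint hI2, integral_eq_zero_iff_of_nonneg_ae
        (by filter_upwards [hP2] with b hb using psd_trace hb) hp2] at hz
      filter_upwards [hz, hP2] with x hx hpx
      rw [psd_zero_of_trace hpx hx, vnEnt_zero]; rfl
    rw [e0, e1, e2, psd_zero_of_trace hPT h0.symm, vnEnt_zero]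
  · have hd : 0 < d := by
      rcases Nat.eq_zero_or_pos d with h | h
      · subst h
        simp [Matrix.trace] at h0
      · exact h
    have t0 := dep_int_tendsto hd hm (fun x => (hP x).isHermitian) (Eventually.of_forall hP) hp hpl
    have t1 := dep_int_tendsto hd hm1 hH1 hP1 hp1 h1l
    have t2 := dep_int_tendsto hd hm2 hH2 hP2 hp2 h2l
    have tT := dep_tendsto hd hPT
    refine le_of_tendsto_of_tendsto' (t0.add tT) (t1.add t2) fun k => ?_
    set ε : ℝ := 1 / ((k : ℝ) + 1) with hε
    have hε0 : 0 < ε := by positivity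
    have hε1 : ε ≤ 1 := by
      rw [hε, div_le_one (by positivity)]
      linarith [(Nat.cast_nonneg k : (0:ℝ) ≤ k)]
    have a1 : ∀ᵐ b ∂μ, dep ε (mint ν (fun c => R (b, c))) = mint ν (fun c => dep ε (R (b, c))) := by
      filter_upwards [hs1] with b hb using (dep_mint hb ε).symm
    have a2 : ∀ᵐ c ∂ν, dep ε (mint μ (fun b => R (b, c))) = mint μ (fun b => dep ε (R (b, c))) := by
      filter_upwards [hs2] with c hc using (dep_mint hc ε).symm
    have key := ssa_delta (δ := ε / d) (by positivity) μ ν (fun x => dep ε (R x))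
      (dep_meas hm ε) (fun x => dep_LB hd hε0.le hε1 (hP x))
      (by simp_rw [dep_trace hd]; exact hp) (by simp_rw [dep_trace hd]; exact hpl)
      (h1l.congr (by filter_upwards [a1] with b hb; rw [← hb, dep_trace hd]))
      (h2l.congr (by filter_upwards [a2] with b hb; rw [← hb, dep_trace hd]))
      (by rw [dep_mint hI, dep_trace hd]; exact h0)
    rw [dep_mint hI] at key
    have i1 : ∫ b, vnEnt (dep ε (mint ν (fun c => R (b, c)))) ∂μ
      = ∫ b, vnEnt (mint ν (fun c => dep ε (R (b, c)))) ∂μ :=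
      integral_congr_ae (by filter_upwards [a1] with b hb; rw [hb])
    have i2 : ∫ c, vnEnt (dep ε (mint μ (fun b => R (b, c)))) ∂ν
      = ∫ c, vnEnt (mint μ (fun b => dep ε (R (b, c)))) ∂ν :=
      integral_congr_ae (by filter_upwards [a2] with b hb; rw [hb])
    rw [i1, i2]
    exact key

end SSAgen

section Smoothing
open Matrix

variable {d : ℕ} {α β γ : Type*} [MeasurableSpace α] [MeasurableSpace β] [MeasurableSpace γ]

theorem ssa_ae (μ : Measure β) (ν : Measure γ) [SFinite μ] [SFinite ν]
    (R : β × γ → Matrix (Fin d) (Fin d) ℂ) (hm : ∀ i j, Measurable (fun x => R x i j))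
    (hP : ∀ᵐ x ∂(μ.prod ν), (R x).PosSemidef)
    (R1 : β → Matrix (Fin d) (Fin d) ℂ) (R2 : γ → Matrix (Fin d) (Fin d) ℂ)
    (h1 : ∀ᵐ b ∂μ, mint ν (fun c => R (b, c)) = R1 b)
    (h2 : ∀ᵐ c ∂ν, mint μ (fun b => R (b, c)) = R2 c)
    (hp : Integrable (fun x => (R x).trace.re) (μ.prod ν))
    (hpl : Integrable (fun x => (R x).trace.re * Real.log (R x).trace.re) (μ.prod ν))
    (h1l : Integrable (fun b => (R1 b).trace.re * Real.log (R1 b).trace.re) μ)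
    (h2l : Integrable (fun c => (R2 c).trace.re * Real.log (R2 c).trace.re) ν) :
    ∫ x, vnEnt (R x) ∂(μ.prod ν) + vnEnt (mint (μ.prod ν) R)
      ≤ ∫ b, vnEnt (R1 b) ∂μ + ∫ c, vnEnt (R2 c) ∂ν := by
  classical
  set N := toMeasurable (μ.prod ν) {x | ¬ (R x).PosSemidef} with hN
  have hNm : MeasurableSet N := measurableSet_toMeasurable _ _
  have hN0 : (μ.prod ν) N = 0 := by rw [hN, measure_toMeasurable]; exact hP
  have hNP : ∀ x, x ∉ N → (R x).PosSemidef := by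
    intro x hx
    by_contra h
    exact hx (subset_toMeasurable _ _ h)
  have hae : ∀ᵐ x ∂(μ.prod ν), x ∈ Nᶜ := by
    rw [ae_iff]; simpa using hN0
  have hae1 : ∀ᵐ b ∂μ, ∀ᵐ c ∂ν, (b, c) ∈ Nᶜ := Measure.ae_ae_of_ae_prod hae
  have hae2 : ∀ᵐ c ∂ν, ∀ᵐ b ∂μ, (b, c) ∈ Nᶜ := by
    rw [← Measure.ae_ae_comm]
    · exact hae1
    · exact hNm.compl
  set R' : β × γ → Matrix (Fin d) (Fin d) ℂ := fun x => if x ∈ N then 0 else R x with hR'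
  have hRR : ∀ x, x ∈ Nᶜ → R' x = R x := fun x hx => if_neg hx
  have e1 : ∀ᵐ b ∂μ, mint ν (fun c => R' (b, c)) = R1 b := by
    filter_upwards [hae1, h1] with b hb hb1
    rw [← hb1]
    ext i j
    simp only [mint_apply]
    refine integral_congr_ae ?_
    filter_upwards [hb] with c hc
    rw [hRR _ hc]
  have e2 : ∀ᵐ c ∂ν, mint μ (fun b => R' (b, c)) = R2 c := by
    filter_upwards [hae2, h2] with b hb hb1
    rw [← hb1]
    ext i j
    simp only [mint_apply]
    refine integral_congr_ae ?_
    filter_upwards [hb] with c hc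
    rw [hRR _ hc]
  have eT : mint (μ.prod ν) R' = mint (μ.prod ν) R := by
    ext i j
    simp only [mint_apply]
    refine integral_congr_ae ?_
    filter_upwards [hae] with c hc
    rw [hRR _ hc]
  have key := ssa μ ν R' (by
      intro i j
      have : (fun x => R' x i j) = fun x => if x ∈ N then 0 else R x i j := by
        ext x
        simp only [hR']
        split_ifs <;> rfl
      rw [this]
      exact Measurable.ite hNm measurable_const (hm i j)) (by
      intro x
      simp only [hR']
      split_ifs with h
      · exact PosSemidef.zero
      · exact hNP x h)
    (hp.congr (by filter_upwards [hae] with x hx; rw [hRR x hx]))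
    (hpl.congr (by filter_upwards [hae] with x hx; rw [hRR x hx]))
    (h1l.congr (by filter_upwards [e1] with x hx; rw [hx]))
    (h2l.congr (by filter_upwards [e2] with x hx; rw [hx]))
  have i0 : ∫ x, vnEnt (R' x) ∂(μ.prod ν) = ∫ x, vnEnt (R x) ∂(μ.prod ν) :=
    integral_congr_ae (by filter_upwards [hae] with x hx; rw [hRR x hx])
  have i1 : ∫ b, vnEnt (mint ν (fun c => R' (b, c))) ∂μ = ∫ b, vnEnt (R1 b) ∂μ :=
    integral_congr_ae (by filter_upwards [e1] with x hx; rw [hx])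
  have i2 : ∫ c, vnEnt (mint μ (fun b => R' (b, c))) ∂ν = ∫ c, vnEnt (R2 c) ∂ν :=
    integral_congr_ae (by filter_upwards [e2] with x hx; rw [hx])
  rw [i0, i1, i2, eT] at key
  exact key

lemma neg_mul_log_le {m r : ℝ} (hm : 0 ≤ m) : -(m * Real.log m) ≤ r * m + Real.exp (-r) := by
  rcases eq_or_lt_of_le hm with h | h
  · rw [← h]; simp; positivity
  · have h1 := negMulLog_le_one' (t := m * Real.exp r) (by positivity)
    rw [Real.negMulLog, Real.log_mul h.ne' (Real.exp_pos _).ne', Real.log_exp] at h1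
    have h2 := mul_le_mul_of_nonneg_left h1 (Real.exp_pos (-r)).le
    have h3 : Real.exp (-r) * (-(m * Real.exp r) * (Real.log m + r)) =
      -(m * (Real.log m + r)) * (Real.exp (-r) * Real.exp r) := by ring
    rw [h3, ← Real.exp_add] at h2
    simp at h2
    linarith

lemma marg_ent (μ : Measure β) (ν : Measure γ) [SFinite μ] [IsProbabilityMeasure ν]
    (Q : β × γ → ℝ) (hQm : Measurable Q) (hQ0 : ∀ x, 0 ≤ Q x) (hQ : Integrable Q (μ.prod ν))
    (hQl : Integrable (fun x => Q x * Real.log (Q x)) (μ.prod ν)) (r : β → ℝ)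
    (hr : Integrable (fun x : β × γ => r x.1 * Q x) (μ.prod ν))
    (hre : Integrable (fun b => Real.exp (-r b)) μ) :
    Integrable (fun b => (∫ c, Q (b, c) ∂ν) * Real.log (∫ c, Q (b, c) ∂ν)) μ := by
  have hmm : Measurable (fun b => ∫ c, Q (b, c) ∂ν) :=
    (hQm.stronglyMeasurable.integral_prod_right' (ν := ν)).measurable
  have hb := (hQl.integral_prod_left.abs.add hr.integral_prod_left.abs).add hre
  refine hb.mono' (hmm.mul hmm.log).aestronglyMeasurable ?_
  filter_upwards [hQ.prod_right_ae, hQl.prod_right_ae] with b h1 h2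
  have hm0 : 0 ≤ ∫ c, Q (b, c) ∂ν := integral_nonneg fun c => hQ0 _
  have hJ := Real.convexOn_mul_log.map_integral_le (μ := ν) (f := fun c => Q (b, c))
    Real.continuous_mul_log.continuousOn isClosed_Ici (Eventually.of_forall fun c => hQ0 (b, c))
    h1 h2
  have hL := neg_mul_log_le (r := r b) hm0
  have hrm : ∫ c, r b * Q (b, c) ∂ν = r b * ∫ c, Q (b, c) ∂ν := integral_const_mul _ _
  simp only [Pi.add_apply]
  rw [Real.norm_eq_abs, abs_le, hrm]
  have p1 := le_abs_self (r b * ∫ c, Q (b, c) ∂ν)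
  have p2 := abs_nonneg (r b * ∫ c, Q (b, c) ∂ν)
  have p3 := le_abs_self (∫ c, Q (b, c) * Real.log (Q (b, c)) ∂ν)
  have p4 := abs_nonneg (∫ c, Q (b, c) * Real.log (Q (b, c)) ∂ν)
  have p5 := Real.exp_pos (-r b)
  constructor <;> linarith

lemma shear {F : Type*} [AddCommGroup F] [MeasurableSpace F] [MeasurableSub₂ F] [MeasurableAdd F]
    (μ : Measure F) [SFinite μ] [μ.IsAddRightInvariant] (m : Measure α) [SFinite m] (φ : α → F)
    (hφ : Measurable φ) :
    MeasurePreserving (fun x : F × α => (x.1 - φ x.2, x.2)) (μ.prod m) (μ.prod m) := by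
  have h := MeasurePreserving.skew_product (MeasurePreserving.id m)
    (g := fun (a : α) (x : F) => x - φ a) (μc := μ) (μd := μ)
    (measurable_snd.sub (hφ.comp measurable_fst))
    (Eventually.of_forall fun a => by
      simpa [sub_eq_add_neg] using (measurePreserving_add_right μ (-φ a)).map_eq)
  have h2 := (Measure.measurePreserving_swap (μ := m) (ν := μ)).comp
    (h.comp (Measure.measurePreserving_swap (μ := μ) (ν := m)))
  exact h2

/-- standard Gaussian measure -/
def gm (n : ℕ) : Measure (En n) :=
  volume.withDensity (fun z => ENNReal.ofReal (gaussDensity n z))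

lemma gd_pos (n : ℕ) (z : En n) : 0 < gaussDensity n z := by
  unfold gaussDensity; positivity

lemma gd_cont (n : ℕ) : Continuous (gaussDensity n) := by
  unfold gaussDensity; fun_prop

lemma gauss_exp_integrable (n : ℕ) {b : ℝ} (hb : 0 < b) :
    Integrable (fun z : En n => Real.exp (-b * ‖z‖ ^ 2)) := by
  have h := GaussianFourier.integral_rexp_neg_mul_sq_norm (V := En n) hb
  by_contra hc
  rw [integral_undef hc] at h
  have : (0:ℝ) < (π / b) ^ (Module.finrank ℝ (En n) / 2 : ℝ) := by positivity
  linarith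

lemma gd_integral (n : ℕ) : ∫ z, gaussDensity n z = 1 := by
  unfold gaussDensity
  rw [integral_const_mul]
  have h := GaussianFourier.integral_rexp_neg_mul_sq_norm (V := En n) (b := 1/2) (by norm_num)
  have e : ∀ z : En n, Real.exp (-‖z‖ ^ 2 / 2) = Real.exp (-(1/2) * ‖z‖ ^ 2) := by
    intro z; congr 1; ring
  simp_rw [e]
  rw [h, finrank_euclideanSpace_fin]
  rw [show π / (1/2) = 2 * π by ring, ← Real.rpow_add (by positivity)]
  rw [show -(n:ℝ) / 2 + n / 2 = 0 by ring, Real.rpow_zero]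

lemma gd_integrable (n : ℕ) : Integrable (gaussDensity n) := by
  by_contra hc
  have := gd_integral n
  rw [integral_undef hc] at this
  norm_num at this

lemma gd_moment (n : ℕ) : Integrable (fun z : En n => gaussDensity n z * ‖z‖ ^ 2) := by
  have h := (gauss_exp_integrable n (b := 1/4) (by norm_num)).const_mul
    ((2 * π) ^ (-(n : ℝ) / 2) * 4)
  refine h.mono' ((gd_cont n).mul (by fun_prop)).aestronglyMeasurable
    (Eventually.of_forall fun z => ?_)
  rw [Real.norm_of_nonneg (mul_nonneg (gd_pos n z).le (by positivity))]
  unfold gaussDensity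
  rw [mul_assoc, mul_assoc]
  refine mul_le_mul_of_nonneg_left ?_ (by positivity)
  have h1 : Real.exp (-‖z‖ ^ 2 / 2) = Real.exp (-(1/4) * ‖z‖ ^ 2) * Real.exp (-(‖z‖^2/4)) := by
    rw [← Real.exp_add]; congr 1; ring
  rw [h1]
  have h2 : ‖z‖ ^ 2 / 4 ≤ Real.exp (‖z‖^2/4) := by linarith [Real.add_one_le_exp (‖z‖^2/4)]
  have h3 : Real.exp (-(‖z‖^2/4)) * Real.exp (‖z‖^2/4) = 1 := by rw [← Real.exp_add]; simp
  have h4 : Real.exp (-(‖z‖^2/4)) * (‖z‖ ^ 2 / 4) ≤ 1 := by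
    rw [← h3]; exact mul_le_mul_of_nonneg_left h2 (Real.exp_pos _).le
  have h5 := Real.exp_pos (-(1/4) * ‖z‖ ^ 2)
  nlinarith

lemma gd_log (n : ℕ) : Integrable (fun z : En n => gaussDensity n z *
    Real.log (gaussDensity n z)) := by
  have h := ((gd_integrable n).mul_const (Real.log ((2 * π) ^ (-(n : ℝ) / 2)))).sub
    ((gd_moment n).mul_const (1/2))
  refine h.congr (Eventually.of_forall fun z => ?_)
  have : Real.log (gaussDensity n z) = Real.log ((2 * π) ^ (-(n : ℝ) / 2)) + (-‖z‖ ^ 2 / 2) := by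
    unfold gaussDensity
    rw [Real.log_mul (by positivity) (Real.exp_pos _).ne', Real.log_exp]
  simp only [Pi.sub_apply]
  rw [this]; ring

instance gm_prob (n : ℕ) : IsProbabilityMeasure (gm n) := by
  constructor
  unfold gm
  rw [withDensity_apply _ MeasurableSet.univ, Measure.restrict_univ,
    ← ofReal_integral_eq_lintegral_ofReal (gd_integrable n)
      (Eventually.of_forall fun z => (gd_pos n z).le), gd_integral, ENNReal.ofReal_one]

lemma gm_integral {E : Type*} [NormedAddCommGroup E] [NormedSpace ℝ E] (n : ℕ) (f : En n → E) :
    ∫ z, f z ∂(gm n) = ∫ z, gaussDensity n z • f z := by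
  unfold gm
  rw [integral_withDensity_eq_integral_toReal_smul
    ((gd_cont n).measurable.ennreal_ofReal) (Eventually.of_forall fun z => by simp)]
  refine integral_congr_ae (Eventually.of_forall fun z => ?_)
  simp only []
  rw [ENNReal.toReal_ofReal (gd_pos n z).le]

lemma gm_moment (n : ℕ) : Integrable (fun z : En n => ‖z‖ ^ 2) (gm n) := by
  unfold gm
  rw [integrable_withDensity_iff_integrable_smul' ((gd_cont n).measurable.ennreal_ofReal)
    (Eventually.of_forall fun z => by simp)]
  refine (gd_moment n).congr (Eventually.of_forall fun z => ?_)
  simp only []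
  rw [ENNReal.toReal_ofReal (gd_pos n z).le, smul_eq_mul]


end Smoothing

section Good
open Matrix

variable {d n : ℕ} {α β γ : Type*} [MeasurableSpace α] [MeasurableSpace β] [MeasurableSpace γ]

lemma mp_integral {E : Type*} [NormedAddCommGroup E] [NormedSpace ℝ E] {μ : Measure α}
    {ν : Measure β} {f : α → β} (hf : MeasurePreserving f μ ν) {g : β → E}
    (hg : AEStronglyMeasurable g ν) : ∫ x, g (f x) ∂μ = ∫ y, g y ∂ν := by
  rw [← hf.map_eq, integral_map hf.aemeasurable]
  rw [hf.map_eq]; exact hg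

/-- Unnormalised classical-quantum families with finite entropy and moment `r`. -/
structure Good {F : Type*} [MeasurableSpace F] (μ : Measure F) (r : F → ℝ)
    (R : F → Matrix (Fin d) (Fin d) ℂ) : Prop where
  meas : ∀ i j, Measurable (fun a => R a i j)
  psd : ∀ a, (R a).PosSemidef
  tr : Integrable (fun a => (R a).trace.re) μ
  trlog : Integrable (fun a => (R a).trace.re * Real.log (R a).trace.re) μ
  mom : Integrable (fun a => r a * (R a).trace.re) μ

/-- admissible weight and shift -/
structure Adm {F : Type*} [AddCommGroup F] [MeasurableSpace F] (μ : Measure F) (r : F → ℝ)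
    (φ : En n → F) : Prop where
  rmeas : Measurable r
  rpos : ∀ a, 0 ≤ r a
  expint : Integrable (fun a => Real.exp (-r a)) μ
  phimeas : Measurable φ
  bd : ∃ K : ℝ, ∀ w z, r w ≤ 2 * r (w - φ z) + K * ‖z‖ ^ 2

/-- Gaussian smoothing along `φ` -/
def smoothM {F : Type*} [AddCommGroup F] (φ : En n → F) (R : F → Matrix (Fin d) (Fin d) ℂ) (w : F) :
    Matrix (Fin d) (Fin d) ℂ := mint (gm n) (fun z => R (w - φ z))

variable {F : Type*} [AddCommGroup F] [MeasurableSpace F] [MeasurableSub₂ F] [MeasurableAdd F]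
  {μ : Measure F} [SFinite μ] [μ.IsAddRightInvariant] {r : F → ℝ}
  {R : F → Matrix (Fin d) (Fin d) ℂ} {φ : En n → F}

lemma Good.ent (h : Good μ r R) : Integrable (fun a => vnEnt (R a)) μ :=
  integrable_vnEnt h.meas (fun a => (h.psd a).isHermitian) (Eventually.of_forall h.psd) h.tr h.trlog

lemma Good.entry (h : Good μ r R) : ∀ i j, Integrable (fun a => R a i j) μ :=
  integrable_entry h.meas h.psd h.tr

lemma shift_integrable {E : Type*} [NormedAddCommGroup E] {f : F → E} (hf : Integrable f μ)
    (hφ : Measurable φ) :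
    Integrable (fun x : F × En n => f (x.1 - φ x.2)) (μ.prod (gm n)) := by
  have h1 : Integrable (fun x : F × En n => f x.1) (μ.prod (gm n)) := hf.comp_fst _
  exact (shear μ (gm n) φ hφ).integrable_comp_of_integrable h1

lemma shift_integral {E : Type*} [NormedAddCommGroup E] [NormedSpace ℝ E] {f : F → E}
    (hf : Integrable f μ) (hφ : Measurable φ) :
    ∫ x : F × En n, f (x.1 - φ x.2) ∂(μ.prod (gm n)) = ∫ a, f a ∂μ := by
  have h1 : Integrable (fun x : F × En n => f x.1) (μ.prod (gm n)) := hf.comp_fst _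
  have := mp_integral (shear μ (gm n) φ hφ) h1.aestronglyMeasurable
  simp only [] at this
  rw [this, integral_fun_fst]
  simp

lemma Good.meas2 (h : Good μ r R) (hφ : Measurable φ) (i j : Fin d) :
    Measurable (fun x : F × En n => R (x.1 - φ x.2) i j) :=
  (h.meas i j).comp (measurable_fst.sub (hφ.comp measurable_snd))

lemma Good.sm_meas (h : Good μ r R) (hφ : Measurable φ) (i j : Fin d) :
    Measurable (fun w => smoothM φ R w i j) :=
  mint_meas_right (h.meas2 hφ) i j

lemma Good.sm_slice (h : Good μ r R) (hφ : Measurable φ) :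
    ∀ᵐ w ∂μ, ∀ i j, Integrable (fun z => R (w - φ z) i j) (gm n) :=
  slice_right (R := fun x : F × En n => R (x.1 - φ x.2))
    (fun i j => shift_integrable (h.entry i j) hφ)

lemma Good.sm_herm (h : Good μ r R) (w : F) : (smoothM φ R w).IsHermitian :=
  mint_herm fun z => (h.psd _).isHermitian

lemma Good.sm_psd (h : Good μ r R) (hφ : Measurable φ) :
    ∀ᵐ w ∂μ, (smoothM φ R w).PosSemidef := by
  filter_upwards [h.sm_slice hφ] with w hw using psd_mint hw fun z => h.psd _

lemma Good.sm_trace (h : Good μ r R) (hφ : Measurable φ) :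
    ∀ᵐ w ∂μ, (smoothM φ R w).trace.re = ∫ z, (R (w - φ z)).trace.re ∂(gm n) := by
  filter_upwards [h.sm_slice hφ] with w hw using trace_mint hw

lemma Good.sm_mint_prod (h : Good μ r R) (hφ : Measurable φ) :
    mint (μ.prod (gm n)) (fun x => R (x.1 - φ x.2)) = mint μ R := by
  ext i j
  simp only [mint_apply]
  exact shift_integral (h.entry i j) hφ

lemma Good.sm_mint (h : Good μ r R) (hφ : Measurable φ) :
    mint μ (smoothM φ R) = mint μ R := by
  rw [← h.sm_mint_prod hφ]
  exact mint_prod_right (R := fun x : F × En n => R (x.1 - φ x.2))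
    (fun i j => shift_integrable (h.entry i j) hφ)

lemma Good.sm_entry (h : Good μ r R) (hφ : Measurable φ) (i j : Fin d) :
    Integrable (fun w => smoothM φ R w i j) μ :=
  (shift_integrable (h.entry i j) hφ).integral_prod_left

lemma Good.sm_tr (h : Good μ r R) (hφ : Measurable φ) :
    Integrable (fun w => (smoothM φ R w).trace.re) μ := by
  simpa using integrable_trace_mul (h.sm_entry hφ) 1

lemma Good.sm_trlog (h : Good μ r R) (hA : Adm μ r φ) :
    Integrable (fun w => (smoothM φ R w).trace.re * Real.log (smoothM φ R w).trace.re) μ := by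
  have hφ := hA.phimeas
  have hQm : Measurable (fun x : F × En n => (R (x.1 - φ x.2)).trace.re) :=
    measurable_trace (h.meas2 hφ)
  have key := marg_ent μ (gm n) (fun x => (R (x.1 - φ x.2)).trace.re)
    hQm (fun x => psd_trace (h.psd _)) (shift_integrable h.tr hφ)
    (shift_integrable h.trlog hφ) r ?_ hA.expint
  · refine key.congr ?_
    filter_upwards [h.sm_trace hφ] with w hw
    rw [hw]
  · obtain ⟨K, hK⟩ := hA.bd
    have h1 := (shift_integrable h.mom hφ).const_mul 2
    have h2 : Integrable (fun x : F × En n => (R x.1).trace.re * ‖x.2‖ ^ 2) (μ.prod (gm n)) :=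
      h.tr.mul_prod (gm_moment n)
    have h3 := (shear μ (gm n) φ hφ).integrable_comp_of_integrable h2
    have h4 := h1.add (h3.const_mul K)
    refine h4.mono' ((hA.rmeas.comp measurable_fst).mul hQm).aestronglyMeasurable
      (Eventually.of_forall fun x => ?_)
    have h0 := psd_trace (h.psd (x.1 - φ x.2))
    rw [Real.norm_of_nonneg (mul_nonneg (hA.rpos _) h0)]
    have h5 := mul_le_mul_of_nonneg_right (hK x.1 x.2) h0
    simp only [Pi.add_apply, Function.comp_apply]
    linarith

lemma Good.sm_ent (h : Good μ r R) (hA : Adm μ r φ) :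
    Integrable (fun w => vnEnt (smoothM φ R w)) μ :=
  integrable_vnEnt (h.sm_meas hA.phimeas) h.sm_herm (h.sm_psd hA.phimeas) (h.sm_tr hA.phimeas)
    (h.sm_trlog hA)

lemma mint_shift (R : F → Matrix (Fin d) (Fin d) ℂ) (v : F) :
    mint μ (fun w => R (w - v)) = mint μ R := by
  ext i j
  simp only [mint_apply]
  exact integral_sub_right_eq_self (fun a => R a i j) v

/-- entropy increases under smoothing -/
lemma Good.sm_mono (h : Good μ r R) (hA : Adm μ r φ) :
    ∫ a, vnEnt (R a) ∂μ ≤ ∫ w, vnEnt (smoothM φ R w) ∂μ := by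
  have hφ := hA.phimeas
  have key := ssa_ae μ (gm n) (fun x => R (x.1 - φ x.2)) (h.meas2 hφ)
    (Eventually.of_forall fun x => h.psd _) (smoothM φ R) (fun _ => mint μ R)
    (Eventually.of_forall fun w => rfl) (Eventually.of_forall fun z => mint_shift R (φ z))
    (shift_integrable h.tr hφ) (shift_integrable h.trlog hφ) (h.sm_trlog hA) (integrable_const _)
  rw [shift_integral h.ent hφ, h.sm_mint_prod hφ] at key
  simp at key
  linarith

end Good

section CQs
open Matrix

variable {d n : ℕ}

/-- weighted family of states -/
def wt {α : Type*} (q : α → ℝ) (σ : α → Matrix (Fin d) (Fin d) ℂ) (a : α) :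
    Matrix (Fin d) (Fin d) ℂ := (q a : ℂ) • σ a

lemma vnEnt_smul {A : Matrix (Fin d) (Fin d) ℂ} (hA : A.PosSemidef) {c : ℝ} (hc : 0 ≤ c) :
    vnEnt ((c : ℂ) • A) = c * vnEnt A + Real.negMulLog c * A.trace.re := by
  have hH : ((c : ℂ) • A).IsHermitian := by
    have := hA.isHermitian
    rw [Matrix.IsHermitian] at this ⊢
    rw [conjTranspose_smul, this]; simp
  have hs := spec_eq hA.isHermitian
  have h2 : (c : ℂ) • A = (hA.isHermitian.eigenvectorUnitary : Matrix (Fin d) (Fin d) ℂ) *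
      diagonal (fun i => ((c * hA.isHermitian.eigenvalues i : ℝ) : ℂ)) *
      (hA.isHermitian.eigenvectorUnitary : Matrix (Fin d) (Fin d) ℂ)ᴴ := by
    conv_lhs => rw [hs]
    rw [← Matrix.smul_mul, ← Matrix.mul_smul]
    congr 2
    ext i j
    by_cases h : i = j <;> simp [h, diagonal]
  rw [vnEnt_negMulLog hH, vnEnt_negMulLog hA.isHermitian, eig_trace hA.isHermitian]
  rw [eig_sum_of_diag Real.negMulLog hH (eu_left hA.isHermitian) _ h2, Finset.mul_sum,
    Finset.mul_sum, ← Finset.sum_add_distrib]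
  refine Finset.sum_congr rfl fun i _ => ?_
  rw [Real.negMulLog_mul]
  ring

lemma smul_psd {A : Matrix (Fin d) (Fin d) ℂ} (hA : A.PosSemidef) {c : ℝ} (hc : 0 ≤ c) :
    ((c : ℂ) • A).PosSemidef := hA.smul (by exact_mod_cast hc)

lemma psd_trace_eq {A : Matrix (Fin d) (Fin d) ℂ} (hA : A.PosSemidef) :
    A.trace = (A.trace.re : ℂ) := by
  have := hA.trace_nonneg
  rw [Complex.le_def] at this
  apply Complex.ext <;> simp [← this.2]

/-- classical-quantum states, a.e. version -/
structure CQ {α : Type*} [MeasureSpace α] (q : α → ℝ) (σ : α → Matrix (Fin d) (Fin d) ℂ) : Prop where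
  nonneg : ∀ a, 0 ≤ q a
  st : ∀ a, q a = 0 ∨ IsState (σ a)
  meas : ∀ i j, Measurable (fun a => wt q σ a i j)
  int : Integrable q
  log : Integrable (fun a => q a * Real.log (q a))

section gen
variable {α : Type*} {q : α → ℝ} {σ : α → Matrix (Fin d) (Fin d) ℂ}

lemma wt_psd (h0 : ∀ a, 0 ≤ q a) (h : ∀ a, q a = 0 ∨ IsState (σ a)) (a : α) :
    (wt q σ a).PosSemidef := by
  rcases h a with h | h
  · rw [wt, h]; simpa using PosSemidef.zero
  · exact smul_psd h.1 (h0 a)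

lemma wt_tr (h : ∀ a, q a = 0 ∨ IsState (σ a)) (a : α) : (wt q σ a).trace.re = q a := by
  rw [wt, trace_smul]
  rcases h a with h | h
  · rw [h]; simp
  · rw [h.2]; simp

lemma wt_ent (h0 : ∀ a, 0 ≤ q a) (h : ∀ a, q a = 0 ∨ IsState (σ a)) (a : α) :
    vnEnt (wt q σ a) = q a * vnEnt (σ a) - q a * Real.log (q a) := by
  rcases h a with h | h
  · rw [wt, h]; simp [vnEnt_zero]
  · rw [wt, vnEnt_smul h.1 (h0 a), h.2, Real.negMulLog]; simp; ring

variable [MeasureSpace α]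

lemma CQ.psd (h : CQ q σ) (a : α) : (wt q σ a).PosSemidef := wt_psd h.nonneg h.st a
lemma CQ.tr (h : CQ q σ) (a : α) : (wt q σ a).trace.re = q a := wt_tr h.st a

lemma CQ.qmeas (h : CQ q σ) : Measurable q := by
  have := measurable_trace h.meas
  simpa only [h.tr] using this

lemma CQ.good (h : CQ q σ) (r : α → ℝ) (hr : Integrable (fun a => r a * q a)) :
    Good volume r (wt q σ) where
  meas := h.meas
  psd := h.psd
  tr := by simpa only [h.tr] using h.int
  trlog := by simpa only [h.tr] using h.log
  mom := by simpa only [h.tr] using hr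

lemma CQ.ent (h : CQ q σ) : Integrable (fun a => vnEnt (wt q σ a)) :=
  integrable_vnEnt h.meas (fun a => (h.psd a).isHermitian) (Eventually.of_forall h.psd)
   (by simpa only [h.tr] using h.int) (by simpa only [h.tr] using h.log)

lemma CQ.condEnt_eq (h : CQ q σ) :
    condEnt q σ = (∫ a, vnEnt (wt q σ a)) - vnEnt (mint volume (wt q σ)) := by
  have h1 : ∀ a, q a * vnEnt (σ a) = vnEnt (wt q σ a) + q a * Real.log (q a) := fun a => by
    rw [wt_ent h.nonneg h.st]; ring
  have h2 : avgState q σ = mint volume (wt q σ) := rfl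
  rw [condEnt, clEnt, h2]
  simp_rw [h1]
  rw [integral_add h.ent h.log]
  ring

/-- facts on a single slice -/
lemma slice_state (h0 : ∀ a, 0 ≤ q a) (h : ∀ a, q a = 0 ∨ IsState (σ a))
    (hm : ∀ i j, Measurable (fun a => wt q σ a i j)) :
    (∫ a, q a = 0 ∨ IsState ((((∫ a, q a : ℝ) : ℂ))⁻¹ • mint volume (wt q σ))) ∧
    (Integrable q → ((∫ a, q a : ℝ) : ℂ) • ((((∫ a, q a : ℝ) : ℂ))⁻¹ • mint volume (wt q σ))
      = mint volume (wt q σ)) := by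
  have key : Integrable q → (mint volume (wt q σ)).PosSemidef ∧
      (mint volume (wt q σ)).trace.re = ∫ a, q a := fun hq => by
    have hI := integrable_entry hm (wt_psd h0 h) (μ := volume) (by simpa only [wt_tr h] using hq)
    refine ⟨psd_mint hI (wt_psd h0 h), ?_⟩
    rw [trace_mint hI]
    simp only [wt_tr h]
  have hnn : 0 ≤ ∫ a, q a := integral_nonneg h0
  constructor
  · by_cases hz : ∫ a, q a = 0
    · exact Or.inl hz
    · right
      have hq : Integrable q := by
        by_contra hc
        exact hz (integral_undef hc)
      obtain ⟨k1, k2⟩ := key hq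
      constructor
      · rw [← Complex.ofReal_inv]
        exact smul_psd k1 (inv_nonneg.2 hnn)
      · rw [trace_smul, psd_trace_eq k1, k2, smul_eq_mul, inv_mul_cancel₀]
        exact_mod_cast hz
  · intro hq
    obtain ⟨k1, k2⟩ := key hq
    by_cases hz : ∫ a, q a = 0
    · rw [hz] at k2
      rw [psd_zero_of_trace k1 k2]; simp
    · rw [smul_smul, mul_inv_cancel₀, one_smul]
      exact_mod_cast hz

lemma CQ.comp {β : Type*} [MeasureSpace β] (h : CQ q σ) {e : β → α}
    (he : MeasurePreserving e volume volume) : CQ (q ∘ e) (σ ∘ e) where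
  nonneg a := h.nonneg _
  st a := h.st _
  meas i j := (h.meas i j).comp he.measurable
  int := he.integrable_comp_of_integrable h.int
  log := he.integrable_comp_of_integrable h.log

end gen

variable {p : En n × En n → ℝ} {ρ : En n × En n → Matrix (Fin d) (Fin d) ℂ}

lemma CQ.slice_meas (h : CQ p ρ) (x : En n) :
   ∀ i j, Measurable (fun y => wt (fun y => p (x, y)) (fun y => ρ (x, y)) y i j) :=
  fun i j => (h.meas i j).comp measurable_prodMk_left

lemma CQ.fst_wt (h : CQ p ρ) :
    ∀ᵐ x, wt (margFst p) (margFstState p ρ) x = mint volume (fun y => wt p ρ (x, y)) := by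
  have h1 : Integrable p (volume.prod volume) := h.int
  filter_upwards [h1.prod_right_ae] with x hx
  exact (slice_state (q := fun y => p (x, y)) (σ := fun y => ρ (x, y)) (fun y => h.nonneg _)
    (fun y => h.st _) (h.slice_meas x)).2 hx

lemma CQ.fst (h : CQ p ρ) (hl : Integrable (fun x => margFst p x * Real.log (margFst p x))) :
    CQ (margFst p) (margFstState p ρ) where
  nonneg x := integral_nonneg fun y => h.nonneg _
  st x := (slice_state (q := fun y => p (x, y)) (σ := fun y => ρ (x, y)) (fun y => h.nonneg _)
    (fun y => h.st _) (h.slice_meas x)).1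
  meas i j := by
    have h1 : Measurable (margFst p) :=
      (h.qmeas.stronglyMeasurable.integral_prod_right' (ν := volume)).measurable
    have h2 := mint_meas_right (ν := (volume : Measure (En n))) h.meas i j
    exact (Complex.measurable_ofReal.comp h1).mul
      ((Complex.measurable_ofReal.comp h1).inv.mul h2)
  int := by
    have h1 : Integrable p (volume.prod volume) := h.int
    exact h1.integral_prod_left
  log := hl

lemma swap_mp : MeasurePreserving (Prod.swap : En n × En n → En n × En n) volume volume :=
  Measure.measurePreserving_swap

lemma sum_mp : MeasurePreserving (fun x : En n × En n => (x.2, x.1 - x.2)) volume volume :=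
  (swap_mp (n := n)).comp (shear (volume : Measure (En n)) (volume : Measure (En n)) id measurable_id)

lemma CQ.condMI_eq (h : CQ p ρ) (hl : Integrable (fun x => margFst p x * Real.log (margFst p x)))
    (hl2 : Integrable (fun x => margSnd p x * Real.log (margSnd p x))) :
    condMI p ρ = (∫ x, vnEnt (mint volume (fun y => wt p ρ (x, y))))
      + (∫ y, vnEnt (mint volume (fun x => wt p ρ (x, y))))
      - (∫ z, vnEnt (wt p ρ z)) - vnEnt (mint volume (wt p ρ)) := by
  have hs := h.comp swap_mp
  have e1 := h.fst_wt
  have e2 := hs.fst_wt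
  have c1 := (h.fst hl).condEnt_eq
  have c2 : condEnt (margSnd p) (margSndState p ρ) = _ := (hs.fst hl2).condEnt_eq
  have hI : ∀ i j, Integrable (fun x => wt p ρ x i j) (volume.prod volume) :=
    integrable_entry h.meas h.psd (by simp only [h.tr]; exact h.int)
  have m1 : mint volume (wt (margFst p) (margFstState p ρ)) = mint volume (wt p ρ) := by
    rw [show mint volume (wt p ρ) = mint (volume.prod volume) (wt p ρ) from rfl,
      ← mint_prod_right hI]
    ext i j
    simp only [mint_apply]
    refine integral_congr_ae ?_
    filter_upwards [e1] with x hx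
    rw [hx]; rfl
  have m2 : mint volume (wt (margFst (p ∘ Prod.swap)) (margFstState (p ∘ Prod.swap) (ρ ∘ Prod.swap)))
      = mint volume (wt p ρ) := by
    rw [show mint volume (wt p ρ) = mint (volume.prod volume) (wt p ρ) from rfl,
      ← mint_prod_left hI]
    ext i j
    simp only [mint_apply]
    refine integral_congr_ae ?_
    filter_upwards [e2] with x hx
    rw [hx]; rfl
  have i1 : ∫ x, vnEnt (wt (margFst p) (margFstState p ρ) x) =
      ∫ x, vnEnt (mint volume (fun y => wt p ρ (x, y))) := by
    refine integral_congr_ae ?_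
    filter_upwards [e1] with x hx
    rw [hx]
  have i2 : ∫ x, vnEnt (wt (margFst (p ∘ Prod.swap)) (margFstState (p ∘ Prod.swap) (ρ ∘ Prod.swap)) x) =
      ∫ y, vnEnt (mint volume (fun x => wt p ρ (x, y))) := by
    refine integral_congr_ae ?_
    filter_upwards [e2] with x hx
    rw [hx]; rfl
  rw [condMI, c1, c2, h.condEnt_eq, m1, m2, i1, i2]
  ring

end CQs

section Noisy
open Matrix

variable {d n : ℕ}

lemma norm_sq_bd (w v : En n) : ‖w‖ ^ 2 ≤ 2 * ‖w - v‖ ^ 2 + 2 * ‖v‖ ^ 2 := by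
  have h := norm_add_le (w - v) v
  rw [sub_add_cancel] at h
  have := pow_le_pow_left₀ (norm_nonneg _) h 2
  nlinarith [sq_nonneg (‖w - v‖ - ‖v‖)]

lemma adm_lin (c : ℝ) : Adm (n := n) volume (fun a : En n => ‖a‖ ^ 2) (fun z => c • z) where
  rmeas := by fun_prop
  rpos a := by positivity
  expint := by simpa using gauss_exp_integrable n (b := 1) one_pos
  phimeas := by fun_prop
  bd := ⟨2 * c ^ 2, fun w z => by
    have := norm_sq_bd w (c • z)
    rw [norm_smul, mul_pow, Real.norm_eq_abs, sq_abs] at this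
    linarith⟩

lemma adm_pair (a b : ℝ) : Adm (n := n) (volume.prod volume)
    (fun x : En n × En n => ‖x.1‖ ^ 2 + ‖x.2‖ ^ 2) (fun z => (a • z, b • z)) where
  rmeas := by fun_prop
  rpos a := by positivity
  expint := by
    have h : Integrable (fun x : En n => Real.exp (-‖x‖ ^ 2)) := by
      simpa using gauss_exp_integrable n (b := 1) one_pos
    refine (h.mul_prod h).congr (Eventually.of_forall fun x => ?_)
    simp only
    rw [← Real.exp_add]; congr 1; ring
  phimeas := by fun_prop
  bd := ⟨2 * a ^ 2 + 2 * b ^ 2, fun w z => by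
    have h1 := norm_sq_bd w.1 (a • z)
    have h2 := norm_sq_bd w.2 (b • z)
    rw [norm_smul, mul_pow, Real.norm_eq_abs, sq_abs] at h1 h2
    simp only [Prod.fst_sub, Prod.snd_sub]
    linarith⟩

variable {q : En n → ℝ} {σ : En n → Matrix (Fin d) (Fin d) ℂ}

lemma vshear (c : ℝ) : MeasurePreserving (fun x : En n × En n => (x.1 - c • x.2, x.2))
    (volume.prod volume) (volume.prod volume) :=
  shear volume volume (fun z => c • z) (by fun_prop)

lemma mul_log_mul (a b : ℝ) : a * b * Real.log (a * b) =
    a * Real.log a * b + a * (b * Real.log b) := by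
  by_cases ha : a = 0
  · simp [ha]
  by_cases hb : b = 0
  · simp [hb]
  rw [Real.log_mul ha hb]; ring

lemma CQ.noisy_log (h : CQ q σ) (c : ℝ) :
    Integrable (fun a : En n × En n => noisyDensity c q a * Real.log (noisyDensity c q a))
      (volume.prod volume) := by
  have h1 := h.int.mul_prod (gd_log n)
  have h2 := h.log.mul_prod (gd_integrable n)
  refine ((vshear c).integrable_comp_of_integrable (h1.add h2)).congr
    (Eventually.of_forall fun x => ?_)
  simp only [noisyDensity, mul_log_mul, Function.comp_apply, Pi.add_apply]
  ring

lemma CQ.noisy (h : CQ q σ) (c : ℝ) : CQ (noisyDensity c q) (noisyState c σ) where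
  nonneg a := mul_nonneg (gd_pos n _).le (h.nonneg _)
  st a := by
    rcases h.st (a.1 - c • a.2) with h | h
    · left; simp [noisyDensity, h]
    · right; exact h
  meas i j := by
    have h1 := (h.meas i j).comp (f := fun x : En n × En n => x.1 - c • x.2) (by fun_prop)
    have h2 : Measurable (fun x : En n × En n => (gaussDensity n x.2 : ℂ)) :=
      (Complex.continuous_ofReal.comp ((gd_cont n).comp continuous_snd)).measurable
    have h3 : (fun a => wt (noisyDensity c q) (noisyState c σ) a i j) = fun x : En n × En n =>
        (gaussDensity n x.2 : ℂ) * wt q σ (x.1 - c • x.2) i j := by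
      ext x
      simp only [wt, noisyDensity, noisyState, Matrix.smul_apply, smul_eq_mul, Complex.ofReal_mul]
      ring
    rw [h3]
    exact h2.mul h1
  int := by
    have h1 := h.int.mul_prod (gd_integrable n)
    refine ((vshear c).integrable_comp_of_integrable h1).congr
      (Eventually.of_forall fun x => ?_)
    simp only [noisyDensity, Function.comp_apply]
    ring
  log := h.noisy_log c

lemma noisy_wt (c : ℝ) (x : En n × En n) : wt (noisyDensity c q) (noisyState c σ) x =
    (gaussDensity n x.2 : ℂ) • wt q σ (x.1 - c • x.2) := by
  simp only [wt, noisyDensity, noisyState, smul_smul, Complex.ofReal_mul]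

lemma noisy_fst (c : ℝ) (w : En n) :
    mint volume (fun z => wt (noisyDensity c q) (noisyState c σ) (w, z)) =
      smoothM (fun z : En n => c • z) (wt q σ) w := by
  ext i j
  rw [smoothM, mint_apply, mint_apply, gm_integral]
  simp only [noisy_wt]
  rfl

lemma noisy_snd (c : ℝ) (z : En n) :
    mint volume (fun w => wt (noisyDensity c q) (noisyState c σ) (w, z)) =
      (gaussDensity n z : ℂ) • mint volume (wt q σ) := by
  rw [← mint_shift (μ := volume) (wt q σ) (c • z)]
  ext i j
  rw [Matrix.smul_apply, mint_apply, mint_apply, smul_eq_mul, ← integral_const_mul]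
  simp only [noisy_wt]
  rfl

lemma CQ.noisyMI_eq (h : CQ q σ) (h1 : ∫ a, q a = 1) (hm : Integrable (fun a => ‖a‖ ^ 2 * q a))
    (c : ℝ) : noisyMI c q σ = (∫ w, vnEnt (smoothM (fun z : En n => c • z) (wt q σ) w))
      - ∫ a, vnEnt (wt q σ a) := by
  have hG := h.good _ hm
  have hN := h.noisy c
  set T := mint volume (wt q σ) with hT
  have hTt : T.trace.re = 1 := by
    rw [hT, trace_mint hG.entry]; simp only [h.tr, h1]
  have hTp : T.PosSemidef := psd_mint hG.entry hG.psd
  have l1 : Integrable (fun x => margFst (noisyDensity c q) x *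
      Real.log (margFst (noisyDensity c q) x)) := by
    refine (hG.sm_trlog (adm_lin c)).congr ?_
    filter_upwards [hG.sm_trace (adm_lin c).phimeas] with w hw
    have : margFst (noisyDensity c q) w = (smoothM (fun z : En n => c • z) (wt q σ) w).trace.re := by
      rw [hw, gm_integral]
      simp only [h.tr]
      rfl
    rw [this]
  have m2 : ∀ z, margSnd (noisyDensity c q) z = gaussDensity n z := fun z => by
    simp only [margSnd, noisyDensity]
    rw [integral_const_mul, integral_sub_right_eq_self (fun a => q a) (c • z), h1, mul_one]
  have l2 : Integrable (fun x => margSnd (noisyDensity c q) x *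
      Real.log (margSnd (noisyDensity c q) x)) := by
    simp only [m2]; exact gd_log n
  rw [noisyMI, hN.condMI_eq l1 l2]
  simp only [noisy_fst, noisy_snd]
  rw [← hT]
  have hnl : Integrable (fun z => Real.negMulLog (gaussDensity n z)) := by
    simpa [Real.negMulLog] using (gd_log n).neg
  have i2 : ∫ z, vnEnt ((gaussDensity n z : ℂ) • T) =
      vnEnt T + ∫ z, Real.negMulLog (gaussDensity n z) := by
    simp only [fun z => vnEnt_smul hTp (gd_pos n z).le, hTt, mul_one]
    rw [integral_add ((gd_integrable n).mul_const _) hnl, integral_mul_const, gd_integral, one_mul]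
  have iT : mint volume (wt (noisyDensity c q) (noisyState c σ)) = T := by
    have hI : ∀ i j, Integrable (fun x => wt (noisyDensity c q) (noisyState c σ) x i j)
        (volume.prod volume) :=
      integrable_entry hN.meas hN.psd (by simp only [hN.tr]; exact hN.int)
    rw [show mint volume (wt (noisyDensity c q) (noisyState c σ)) =
      mint (volume.prod volume) (wt (noisyDensity c q) (noisyState c σ)) from rfl,
      ← mint_prod_left hI]
    simp only [noisy_snd, ← hT]
    ext i j
    simp only [mint_apply, Matrix.smul_apply, smul_eq_mul]
    rw [integral_mul_const, integral_complex_ofReal, gd_integral]; simp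
  have i3 : ∫ x, vnEnt (wt (noisyDensity c q) (noisyState c σ) x) =
      (∫ a, vnEnt (wt q σ a)) + ∫ z, Real.negMulLog (gaussDensity n z) := by
    have k1 := h.ent.mul_prod (gd_integrable n)
    have k2 := h.int.mul_prod hnl
    have k3 := mp_integral (vshear c) (k1.add k2).aestronglyMeasurable
    have k4 : ∫ x : En n × En n, vnEnt (wt (noisyDensity c q) (noisyState c σ) x)
       = ∫ x : En n × En n, ((fun z : En n × En n => vnEnt (wt q σ z.1) * gaussDensity n z.2) +
          fun z : En n × En n => q z.1 * Real.negMulLog (gaussDensity n z.2))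
          (x.1 - c • x.2, x.2) ∂(volume.prod volume) := by
      refine integral_congr_ae (Eventually.of_forall fun x => ?_)
      simp only [noisy_wt, fun z => vnEnt_smul (h.psd z) (gd_pos n x.2).le, h.tr, Pi.add_apply]
      ring
    rw [k4, k3, integral_add' k1 k2, integral_prod_mul (fun a => vnEnt (wt q σ a)) (gaussDensity n),
      integral_prod_mul (fun a => q a) (fun z => Real.negMulLog (gaussDensity n z)), h1, gd_integral]
    ring
  rw [i2, iT, i3]
  ring

end Noisy

section Key
open Matrix

variable {d n : ℕ}

/-- squared norm weight on pairs -/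
def r2 (x : En n × En n) : ℝ := ‖x.1‖ ^ 2 + ‖x.2‖ ^ 2
/-- squared norm weight -/
def r1 (x : En n) : ℝ := ‖x‖ ^ 2

/-- the pair of shifts -/
def phi (a b : ℝ) (z : En n) : En n × En n := (a • z, b • z)

lemma adm1 (c : ℝ) : Adm (n := n) volume r1 (fun z => c • z) := adm_lin c
lemma adm2 (a b : ℝ) : Adm (n := n) (volume.prod volume) r2 (phi a b) := adm_pair a b

lemma shift_ae {F : Type*} [AddCommGroup F] [MeasurableSpace F] [MeasurableSub₂ F] [MeasurableAdd F]
    {μ : Measure F} [SFinite μ] [μ.IsAddRightInvariant] {φ : En n → F} (hφ : Measurable φ)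
    {P : F → Prop} (h : ∀ᵐ a ∂μ, P a) : ∀ᵐ w ∂μ, ∀ᵐ z ∂(gm n), P (w - φ z) := by
  have h1 : ∀ᵐ x ∂(μ.prod (gm n)), P x.1 := Measure.quasiMeasurePreserving_fst.ae h
  have h2 := (shear μ (gm n) φ hφ).quasiMeasurePreserving.ae h1
  exact Measure.ae_ae_of_ae_prod h2

variable {R : En n × En n → Matrix (Fin d) (Fin d) ℂ} {RX RY RS : En n → Matrix (Fin d) (Fin d) ℂ}

/-- reassociation -/
lemma assoc_mp (n : ℕ) : MeasurePreserving
    (fun x : En n × (En n × En n) => ((x.1, x.2.1), x.2.2))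
    ((volume : Measure (En n)).prod ((volume : Measure (En n)).prod (gm n)))
    (((volume : Measure (En n)).prod (volume : Measure (En n))).prod (gm n)) :=
  (measurePreserving_prodAssoc (volume : Measure (En n)) (volume : Measure (En n)) (gm n)).symm

lemma sumassoc_mp (n : ℕ) : MeasurePreserving
    (fun x : En n × (En n × En n) => ((x.2.1, x.1 - x.2.1), x.2.2))
    ((volume : Measure (En n)).prod ((volume : Measure (En n)).prod (gm n)))
    (((volume : Measure (En n)).prod (volume : Measure (En n))).prod (gm n)) := by
  have h : MeasurePreserving (fun x : En n × En n => (x.2, x.1 - x.2))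
    ((volume : Measure (En n)).prod (volume : Measure (En n)))
    ((volume : Measure (En n)).prod (volume : Measure (En n))) := sum_mp
  exact (h.prod (MeasurePreserving.id (gm n))).comp (assoc_mp n)

lemma fst_margin (hR : Good (volume.prod volume) r2 R)
    (eX : ∀ᵐ x, RX x = mint volume (fun y => R (x, y))) (a b : ℝ) :
    ∀ᵐ w, mint volume (fun y => smoothM (phi a b) R (w, y)) = smoothM (fun z : En n => a • z) RX w := by
  have hI : ∀ i j, Integrable (fun x : En n × (En n × En n) =>
      R ((x.1, x.2.1) - phi a b x.2.2) i j) (volume.prod (volume.prod (gm n))) := fun i j =>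
    (assoc_mp n).integrable_comp_of_integrable
      (shift_integrable (hR.entry i j) (adm2 a b).phimeas)
  have hI2 := slice_right (R := fun x : En n × (En n × En n) => R ((x.1, x.2.1) - phi a b x.2.2)) hI
  have hs := shift_ae (adm1 (n := n) a).phimeas eX
  filter_upwards [hI2, hs] with w h1 h2
  have e1 := mint_prod_right (R := fun x : En n × En n => R ((w, x.1) - phi a b x.2)) h1
  have e2 := mint_prod_left (R := fun x : En n × En n => R ((w, x.1) - phi a b x.2)) h1
  have e3 : mint volume (fun y => smoothM (phi a b) R (w, y)) = _ := e1.trans e2.symm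
  rw [e3]
  ext i j
  rw [smoothM, mint_apply, mint_apply]
  refine integral_congr_ae ?_
  filter_upwards [h2] with z hz
  rw [hz]
  have e4 := mint_shift (μ := (volume : Measure (En n))) (fun y => R (w - a • z, y)) (b • z)
  rw [← e4]
  rfl

lemma good_swap (hR : Good (volume.prod volume) r2 R) :
    Good (volume.prod volume) r2 (fun x => R x.swap) := by
  have hs : MeasurePreserving (Prod.swap : En n × En n → En n × En n) (volume.prod volume)
    (volume.prod volume) := swap_mp
  refine ⟨fun i j => (hR.meas i j).comp measurable_swap, fun a => hR.psd _,
    hs.integrable_comp_of_integrable hR.tr, hs.integrable_comp_of_integrable hR.trlog, ?_⟩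
  refine (hs.integrable_comp_of_integrable hR.mom).congr (Eventually.of_forall fun x => ?_)
  simp only [Function.comp_apply, r2, Prod.fst_swap, Prod.snd_swap]
  ring

lemma step2 (hR : Good (volume.prod volume) r2 R) (hX : Good volume r1 RX) (hY : Good volume r1 RY)
    (eX : ∀ᵐ x, RX x = mint volume (fun y => R (x, y)))
    (eY : ∀ᵐ y, RY y = mint volume (fun x => R (x, y))) (a b : ℝ) :
    ∫ x, vnEnt (smoothM (phi a b) R x) ∂(volume.prod volume)
      + vnEnt (mint (volume.prod volume) R) ≤
      (∫ x, vnEnt (smoothM (fun z : En n => a • z) RX x)) +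
      ∫ x, vnEnt (smoothM (fun z : En n => b • z) RY x) := by
  have hA := adm2 (n := n) a b
  have h2 := fst_margin (good_swap hR) eY b a
  have key := ssa_ae volume volume (smoothM (phi a b) R) (hR.sm_meas hA.phimeas)
    (hR.sm_psd hA.phimeas) (smoothM (fun z : En n => a • z) RX) (smoothM (fun z : En n => b • z) RY)
    (fst_margin hR eX a b) h2 (hR.sm_tr hA.phimeas) (hR.sm_trlog hA)
    (hX.sm_trlog (adm1 a)) (hY.sm_trlog (adm1 b))
  rwa [hR.sm_mint hA.phimeas] at key

lemma step1 (hR : Good (volume.prod volume) r2 R) (hS : Good volume r1 RS)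
    (eS : ∀ᵐ s, RS s = mint volume (fun x => R (x, s - x))) (a b : ℝ) :
    ∫ x, vnEnt (R x) ∂(volume.prod volume)
      + ∫ s, vnEnt (smoothM (fun z : En n => (a + b) • z) RS s) ∂volume ≤
      ∫ x, vnEnt (smoothM (phi a b) R x) ∂(volume.prod volume) + ∫ s, vnEnt (RS s) ∂volume := by
  have hA := adm2 (n := n) a b
  have hB := adm1 (n := n) (a + b)
  set Q : En n × (En n × En n) → Matrix (Fin d) (Fin d) ℂ :=
    fun x => R ((x.2.1, x.1 - x.2.1) - phi a b x.2.2) with hQ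
  have hsum : MeasurePreserving (fun x : En n × En n => (x.2, x.1 - x.2))
    ((volume : Measure (En n)).prod (volume : Measure (En n)))
    ((volume : Measure (En n)).prod (volume : Measure (En n))) := sum_mp
  have hQm : ∀ i j, Measurable (fun x => Q x i j) := fun i j =>
    (hR.meas2 hA.phimeas i j).comp (sumassoc_mp n).measurable
  have trans : ∀ {E : Type} [NormedAddCommGroup E] (f : En n × En n → E),
      Integrable f (volume.prod volume) → Integrable
      (fun x : En n × (En n × En n) => f ((x.2.1, x.1 - x.2.1) - phi a b x.2.2))
      (volume.prod (volume.prod (gm n))) := fun f hf =>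
    (sumassoc_mp n).integrable_comp_of_integrable (shift_integrable hf hA.phimeas)
  have i_tr := trans _ hR.tr
  have i_trlog := trans _ hR.trlog
  have i_ent := trans _ hR.ent
  have i_entry := fun i j => trans _ (hR.entry i j)
  have j_trlog := hsum.integrable_comp_of_integrable (hR.sm_trlog hA)
  have j_ent := hsum.integrable_comp_of_integrable (hR.sm_ent hA)
  have k_trlog := shift_integrable hS.trlog hB.phimeas
  have k_ent := shift_integrable hS.ent hB.phimeas
  have hs := shift_ae hB.phimeas eS
  have main : ∀ᵐ s : En n, ∫ x, vnEnt (Q (s, x)) ∂(volume.prod (gm n))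
      + vnEnt (smoothM (fun z : En n => (a + b) • z) RS s) ≤
      ∫ u, vnEnt (smoothM (phi a b) R (u, s - u)) ∂volume
        + ∫ z, vnEnt (RS (s - (a + b) • z)) ∂(gm n) := by
    filter_upwards [i_tr.prod_right_ae, i_trlog.prod_right_ae, slice_right (R := Q) i_entry,
      j_trlog.prod_right_ae, k_trlog.prod_right_ae, hs] with s g1 g2 g3 g4 g5 g6
    have e2 : ∀ᵐ z ∂(gm n), mint volume (fun u => Q (s, (u, z))) = RS (s - (a + b) • z) := by
      filter_upwards [g6] with z hz
      rw [hz]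
      have e4 := mint_shift (μ := (volume : Measure (En n)))
        (fun x => R (x, s - (a + b) • z - x)) (a • z)
      rw [← e4]
      congr 1
      funext u
      simp only [hQ, phi]
      congr 1
      refine Prod.ext rfl ?_
      simp only [Prod.snd_sub]
      rw [add_smul]; abel
    have e3 : mint (volume.prod (gm n)) (fun x => Q (s, x)) =
        smoothM (fun z : En n => (a + b) • z) RS s := by
      rw [← mint_prod_left (R := fun x => Q (s, x)) g3]
      ext i j
      rw [smoothM, mint_apply, mint_apply]
      refine integral_congr_ae ?_
      filter_upwards [e2] with z hz
      rw [hz]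
    have key := ssa_ae volume (gm n) (fun x => Q (s, x))
      (fun i j => (hQm i j).comp measurable_prodMk_left)
      (Eventually.of_forall fun x => hR.psd _) (fun u => smoothM (phi a b) R (u, s - u))
      (fun z => RS (s - (a + b) • z)) (Eventually.of_forall fun u => rfl) e2 g1 g2 g4 g5
    rwa [e3] at key
  have f1 := integral_mono_ae (i_ent.integral_prod_left.add (hS.sm_ent hB))
    (j_ent.integral_prod_left.add k_ent.integral_prod_left) main
  rw [integral_add' i_ent.integral_prod_left (hS.sm_ent hB),
    integral_add' j_ent.integral_prod_left k_ent.integral_prod_left] at f1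
  have t1 : ∫ s, ∫ x, vnEnt (Q (s, x)) ∂(volume.prod (gm n)) ∂volume =
      ∫ x, vnEnt (R x) ∂(volume.prod volume) := by
    rw [← shift_integral hR.ent hA.phimeas, ← integral_prod _ i_ent]
    exact mp_integral (sumassoc_mp n) (shift_integrable hR.ent hA.phimeas).aestronglyMeasurable
  have t2 : ∫ s, ∫ u, vnEnt (smoothM (phi a b) R (u, s - u)) ∂volume ∂volume =
      ∫ x, vnEnt (smoothM (phi a b) R x) ∂(volume.prod volume) := by
    rw [← mp_integral hsum (hR.sm_ent hA).aestronglyMeasurable]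
    exact (integral_prod _ j_ent).symm
  have t3 : ∫ s, ∫ z, vnEnt (RS (s - (a + b) • z)) ∂(gm n) ∂volume = ∫ s, vnEnt (RS s) ∂volume := by
    rw [← shift_integral hS.ent hB.phimeas]
    exact (integral_prod _ k_ent).symm
  rw [← t1, ← t2, ← t3]
  exact f1

end Key

section Fin
open Matrix

variable {d n : ℕ}

/-- a normalised classical-quantum state with second moment -/
structure CQ1 (q : En n → ℝ) (σ : En n → Matrix (Fin d) (Fin d) ℂ) : Prop where
  cq : CQ q σ
  one : ∫ a, q a = 1
  mom : Integrable (fun a => ‖a‖ ^ 2 * q a)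

section one
variable {q : En n → ℝ} {σ : En n → Matrix (Fin d) (Fin d) ℂ}

lemma CQ1.nmi_nonneg (h : CQ1 q σ) (c : ℝ) : 0 ≤ noisyMI c q σ := by
  rw [h.cq.noisyMI_eq h.one h.mom c]
  exact sub_nonneg.2 ((h.cq.good _ h.mom).sm_mono (adm_lin c))

lemma CQ1.nmi_zero (h : CQ1 q σ) : noisyMI 0 q σ = 0 := by
  rw [h.cq.noisyMI_eq h.one h.mom 0]
  have : ∀ w, smoothM (fun z : En n => (0 : ℝ) • z) (wt q σ) w = wt q σ w := fun w => by
    ext i j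
    rw [smoothM, mint_apply]
    simp
  simp only [this, sub_self]

lemma scale_limsup (u : ℝ → EReal) {l : ℝ} (h0 : 0 < l) :
    limsup (fun t : ℝ => ((l ^ 2 : ℝ) : EReal) * u (l ^ 2 * t)) (𝓝[>] (0 : ℝ)) ≤
      ((l ^ 2 : ℝ) : EReal) * limsup u (𝓝[>] (0 : ℝ)) := by
  have h2 : (0 : EReal) ≤ ((l ^ 2 : ℝ) : EReal) := EReal.coe_nonneg.2 (sq_nonneg l)
  rw [EReal.limsup_const_mul_of_nonneg_of_ne_top h2 (EReal.coe_ne_top _)]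
  refine mul_le_mul_of_nonneg_left ?_ h2
  have ht : Tendsto (fun t : ℝ => l ^ 2 * t) (𝓝[>] 0) (𝓝[>] 0) := by
    refine tendsto_nhdsWithin_iff.2 ⟨?_, ?_⟩
    · have : Tendsto (fun t : ℝ => l ^ 2 * t) (𝓝 0) (𝓝 (l ^ 2 * 0)) :=
        (continuous_const.mul continuous_id).tendsto 0
      rw [mul_zero] at this
      exact this.mono_left nhdsWithin_le_nhds
    · filter_upwards [self_mem_nhdsWithin] with t ht
      exact mul_pos (pow_pos h0 2) (Set.mem_Ioi.1 ht)
  have h3 := limsup_comp u (fun t : ℝ => l ^ 2 * t) (𝓝[>] 0)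
  have h4 : limsup (fun t : ℝ => u (l ^ 2 * t)) (𝓝[>] 0) =
    limsup u (map (fun t : ℝ => l ^ 2 * t) (𝓝[>] 0)) := h3
  rw [h4]
  exact limsup_le_limsup_of_le ht

lemma scale_slope (f : ℝ → ℝ) {l : ℝ} (hl : 0 < l) (t : ℝ) :
    f (l * Real.sqrt t) / t = l ^ 2 * (f (Real.sqrt (l ^ 2 * t)) / (l ^ 2 * t)) := by
  rw [Real.sqrt_mul (sq_nonneg l), Real.sqrt_sq hl.le]
  by_cases ht : t = 0
  · simp [ht]
  · have := hl.ne'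
    field_simp

lemma CQ1.slope_limsup (h : CQ1 q σ) {l : ℝ} (hl : 0 ≤ l) :
    limsup (fun t : ℝ => ((noisyMI (l * Real.sqrt t) q σ / t : ℝ) : EReal)) (𝓝[>] (0 : ℝ)) ≤
      ((l ^ 2 : ℝ) : EReal) * condFisher q σ := by
  rcases eq_or_lt_of_le hl with h0 | h0
  · rw [← h0]
    have e : ∀ t : ℝ, noisyMI (0 * Real.sqrt t) q σ / t = 0 := fun t => by
      rw [zero_mul, h.nmi_zero, zero_div]
    simp only [e]
    rw [limsup_const, zero_pow two_ne_zero, EReal.coe_zero, zero_mul]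
  · have e : ∀ t : ℝ, ((noisyMI (l * Real.sqrt t) q σ / t : ℝ) : EReal) =
        ((l ^ 2 : ℝ) : EReal) * ((fisherSlope q σ (l ^ 2 * t) : ℝ) : EReal) := fun t => by
      rw [← EReal.coe_mul, fisherSlope, ← scale_slope (fun c => noisyMI c q σ) h0 t]
    simp only [e]
    rw [condFisher]
    exact scale_limsup (fun t => ((fisherSlope q σ t : ℝ) : EReal)) h0

end one

variable {p : En n × En n → ℝ} {ρ : En n × En n → Matrix (Fin d) (Fin d) ℂ}

lemma CQ.marg1 (h : CQ p ρ) (h1 : ∫ x, p x = 1)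
    (hl : Integrable (fun x => margFst p x * Real.log (margFst p x)))
    (hm : Integrable (fun x : En n × En n => ‖x.1‖ ^ 2 * p x)) :
    CQ1 (margFst p) (margFstState p ρ) := by
  refine ⟨h.fst hl, ?_, ?_⟩
  · have hi : Integrable p (volume.prod volume) := h.int
    exact (integral_prod p hi).symm.trans h1
  · have hi : Integrable (fun x : En n × En n => ‖x.1‖ ^ 2 * p x) (volume.prod volume) := hm
    have := hi.integral_prod_left
    simp only [integral_const_mul] at this
    exact this

lemma nmi_ineq (h : CQ p ρ) (h1 : ∫ x, p x = 1)
    (hX2 : Integrable fun z : En n × En n => ‖z.1‖ ^ 2 * p z)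
    (hY2 : Integrable fun z : En n × En n => ‖z.2‖ ^ 2 * p z)
    (hX : Integrable (fun x => margFst p x * Real.log (margFst p x)))
    (hY : Integrable (fun x => margSnd p x * Real.log (margSnd p x)))
    (hS : Integrable (fun x => sumDensity p x * Real.log (sumDensity p x)))
    (hindep : condMI p ρ = 0) :
    CQ1 (margFst p) (margFstState p ρ) ∧ CQ1 (margSnd p) (margSndState p ρ) ∧
    CQ1 (sumDensity p) (sumState p ρ) ∧
    ∀ a b : ℝ, noisyMI (a + b) (sumDensity p) (sumState p ρ) ≤
      noisyMI a (margFst p) (margFstState p ρ) + noisyMI b (margSnd p) (margSndState p ρ) := by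
  have hsw := h.comp swap_mp
  have hsu := h.comp sum_mp
  have i1 : ∀ {e : En n × En n → En n × En n}, MeasurePreserving e volume volume →
      ∫ x, (p ∘ e) x = 1 := fun he => by
    rw [← h1]; exact mp_integral he h.int.aestronglyMeasurable
  have cX := h.marg1 h1 hX hX2
  have cY : CQ1 (margSnd p) (margSndState p ρ) := hsw.marg1 (i1 swap_mp) hY
    ((swap_mp (n := n)).integrable_comp_of_integrable hY2)
  have hS2 : Integrable (fun z : En n × En n => ‖z.1 + z.2‖ ^ 2 * p z) := by
    refine ((hX2.add hY2).const_mul 2).mono' ?_ (Eventually.of_forall fun z => ?_)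
    · have : Measurable (fun z : En n × En n => ‖z.1 + z.2‖ ^ 2) := by fun_prop
      exact (this.mul h.qmeas).aestronglyMeasurable
    · rw [Real.norm_of_nonneg (mul_nonneg (by positivity) (h.nonneg _))]
      have hb := norm_sq_bd (z.1 + z.2) z.2
      rw [add_sub_cancel_right] at hb
      have := mul_le_mul_of_nonneg_right hb (h.nonneg z)
      simp only [Pi.add_apply]
      linarith
  have cS : CQ1 (sumDensity p) (sumState p ρ) := by
    refine hsu.marg1 (i1 sum_mp) hS ?_
    refine ((sum_mp (n := n)).integrable_comp_of_integrable hS2).congr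
      (Eventually.of_forall fun z => ?_)
    simp
  refine ⟨cX, cY, cS, fun a b => ?_⟩
  have eX := h.fst_wt
  have eY : ∀ᵐ y, wt (margSnd p) (margSndState p ρ) y = mint volume (fun x => wt p ρ (x, y)) :=
    hsw.fst_wt
  have eS : ∀ᵐ s, wt (sumDensity p) (sumState p ρ) s =
    mint volume (fun x => wt p ρ (x, s - x)) := hsu.fst_wt
  have gR : Good (volume.prod volume) r2 (wt p ρ) := h.good r2 (by
    refine (hX2.add hY2).congr (Eventually.of_forall fun z => ?_)
    simp only [r2, Pi.add_apply]; ring)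
  have gX : Good volume r1 (wt (margFst p) (margFstState p ρ)) := cX.cq.good _ cX.mom
  have gY : Good volume r1 (wt (margSnd p) (margSndState p ρ)) := cY.cq.good _ cY.mom
  have gS : Good volume r1 (wt (sumDensity p) (sumState p ρ)) := cS.cq.good _ cS.mom
  have s1 := step1 gR gS eS a b
  have s2 := step2 gR gX gY eX eY a b
  have hM := h.condMI_eq hX hY
  rw [hindep] at hM
  have j1 : ∫ x, vnEnt (wt (margFst p) (margFstState p ρ) x) =
      ∫ x, vnEnt (mint volume (fun y => wt p ρ (x, y))) := by
    refine integral_congr_ae ?_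
    filter_upwards [eX] with x hx
    rw [hx]
  have j2 : ∫ x, vnEnt (wt (margSnd p) (margSndState p ρ) x) =
      ∫ y, vnEnt (mint volume (fun x => wt p ρ (x, y))) := by
    refine integral_congr_ae ?_
    filter_upwards [eY] with x hx
    rw [hx]
  rw [← j1, ← j2] at hM
  rw [cX.cq.noisyMI_eq cX.one cX.mom, cY.cq.noisyMI_eq cY.one cY.mom,
    cS.cq.noisyMI_eq cS.one cS.mom]
  have v1 : ∫ z, vnEnt (wt p ρ z) = ∫ z, vnEnt (wt p ρ z) ∂(volume.prod volume) := rfl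
  have v2 : mint volume (wt p ρ) = mint (volume.prod volume) (wt p ρ) := rfl
  rw [v1, v2] at hM
  linarith

end Fin

/-- The linear Stam inequality with quantum conditioning: for `X`, `Y` conditionally
independent given the quantum system `M` and `0 ≤ λ ≤ 1`,
`J(X+Y|M) ≤ λ² J(X|M) + (1-λ)² J(Y|M)`. -/
theorem linear_stam_inequality_quantum_conditioning {n d : ℕ}
    (p : En n × En n → ℝ) (ρ : En n × En n → Matrix (Fin d) (Fin d) ℂ)
    (hcq : IsCQState p ρ)
    (hX2 : Integrable fun z : En n × En n => ‖z.1‖ ^ 2 * p z)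
    (hY2 : Integrable fun z : En n × En n => ‖z.2‖ ^ 2 * p z)
    (hXYfin : EntFinite p ρ)
    (hXfin : EntFinite (margFst p) (margFstState p ρ))
    (hYfin : EntFinite (margSnd p) (margSndState p ρ))
    (hSfin : EntFinite (sumDensity p) (sumState p ρ))
    (hindep : condMI p ρ = 0) :
    ∀ l : ℝ, 0 ≤ l → l ≤ 1 →
      condFisher (sumDensity p) (sumState p ρ)
        ≤ ((l ^ 2 : ℝ) : EReal) * condFisher (margFst p) (margFstState p ρ)
          + (((1 - l) ^ 2 : ℝ) : EReal) * condFisher (margSnd p) (margSndState p ρ) := by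
  obtain ⟨hpm, hp0, hp1, hρc, hρs⟩ := hcq
  have hpi : Integrable p := by
    by_contra hc
    rw [integral_undef hc] at hp1
    exact zero_ne_one hp1
  have h : CQ p ρ := by
    refine ⟨hp0, fun a => Or.inr (hρs a), fun i j => ?_, hpi, hXYfin.1⟩
    have h1 : Measurable (fun a => ρ a i j) :=
      ((continuous_apply j).comp ((continuous_apply i).comp hρc)).measurable
    exact (Complex.measurable_ofReal.comp hpm).mul h1
  obtain ⟨cX, cY, cS, key⟩ := nmi_ineq h hp1 hX2 hY2 hXfin.1 hYfin.1 hSfin.1 hindep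
  intro l hl0 hl1
  set u : ℝ → EReal := fun t =>
    ((noisyMI (l * Real.sqrt t) (margFst p) (margFstState p ρ) / t : ℝ) : EReal) with hu
  set v : ℝ → EReal := fun t =>
    ((noisyMI ((1 - l) * Real.sqrt t) (margSnd p) (margSndState p ρ) / t : ℝ) : EReal) with hv
  have hpos : ∀ᶠ t : ℝ in 𝓝[>] 0, 0 < t := self_mem_nhdsWithin
  have u0 : (0 : EReal) ≤ limsup u (𝓝[>] 0) := by
    refine le_limsup_of_frequently_le' (Eventually.frequently ?_)
    filter_upwards [hpos] with t ht
    exact EReal.coe_nonneg.2 (div_nonneg (cX.nmi_nonneg _) ht.le)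
  have v0 : (0 : EReal) ≤ limsup v (𝓝[>] 0) := by
    refine le_limsup_of_frequently_le' (Eventually.frequently ?_)
    filter_upwards [hpos] with t ht
    exact EReal.coe_nonneg.2 (div_nonneg (cY.nmi_nonneg _) ht.le)
  have u1 : limsup u (𝓝[>] 0) ≠ ⊥ := fun hb => by rw [hb] at u0; exact absurd u0 (by simp)
  have v1 : limsup v (𝓝[>] 0) ≠ ⊥ := fun hb => by rw [hb] at v0; exact absurd v0 (by simp)
  have hle : condFisher (sumDensity p) (sumState p ρ) ≤ limsup (u + v) (𝓝[>] 0) := by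
    refine limsup_le_limsup ?_
    filter_upwards [hpos] with t ht
    simp only [hu, hv, Pi.add_apply, ← EReal.coe_add, EReal.coe_le_coe_iff, fisherSlope]
    rw [← add_div]
    refine div_le_div_of_nonneg_right ?_ ht.le
    have := key (l * Real.sqrt t) ((1 - l) * Real.sqrt t)
    rwa [← add_mul, add_sub_cancel, one_mul] at this
  refine hle.trans ((EReal.limsup_add_le (Or.inl u1) (Or.inr v1)).trans ?_)
  exact add_le_add (cX.slope_limsup hl0) (cY.slope_limsup (by linarith))

end
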